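/- There exist a continuous function f : ℝ → ℝ with f(x) > 0 for every x and ∫_ℝ f = 1, a real ε > 0 and a constant C such that: (a) the laws of (Q_n − q_n)/n converge weakly, as n → ∞, to the probability measure on ℝ whose density with respect to Lebesgue measure is f; and (b) for every integer n ≥ 1 and every integer x, |P(Q_n = x) − n^{−1} f((x − q_n)/n)| ≤ C n^{−1−ε}. -/

import Mathlib

open MeasureTheory ProbabilityTheory Filter BoundedContinuousFunction

/-- Binary convolution of laws on `ℤ` (the law of the sum of independent variables). -/
noncomputable def mconvZ (μ ν : Measure ℤ) : Measure ℤ :=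
  μ.bind (fun x => ν.map (fun y => x + y))

/-- `μ n` is the law of `Q_n`, the number of key comparisons used by QuickSort on `n` keys. -/
def IsQuicksortLaw (μ : ℕ → Measure ℤ) : Prop :=
  (∀ n, IsProbabilityMeasure (μ n)) ∧
  μ 0 = Measure.dirac 0 ∧ μ 1 = Measure.dirac 0 ∧
  ∀ n : ℕ, 2 ≤ n →
    μ n = (n : ENNReal)⁻¹ •
      ∑ u ∈ Finset.Icc 1 n,
        (mconvZ (μ (u - 1)) (μ (n - u))).map (fun x => x + ((n : ℤ) - 1))

/-- The mean `q_n = E Q_n` of a law on `ℤ`. -/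
noncomputable def meanZ (ν : Measure ℤ) : ℝ := ∫ k, (k : ℝ) ∂ν

namespace IsQuicksortLaw

open Finset.HasAntidiagonal (antidiagonal)

lemma mconvZ_eq_map_prod (ν ρ : Measure ℤ) [SFinite ν] [SFinite ρ] :
    mconvZ ν ρ = (ν.prod ρ).map (fun x => x.1 + x.2) := by
  ext s hs
  rw [mconvZ, Measure.bind_apply hs (Measurable.of_discrete).aemeasurable,
    Measure.map_apply (by fun_prop) hs, Measure.prod_apply (hs.preimage (by fun_prop))]
  refine lintegral_congr fun x => ?_
  rw [Measure.map_apply (by fun_prop) hs]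
  rfl

lemma law_succ {μ : ℕ → Measure ℤ} (hμ : IsQuicksortLaw μ) (n : ℕ) :
    μ (n + 1) = ((n + 1 : ℕ) : ENNReal)⁻¹ • ∑ p ∈ antidiagonal n,
      ((μ p.1).prod (μ p.2)).map (fun x => x.1 + x.2 + (n : ℤ)) := by
  obtain ⟨hp, h0, h1, hrec⟩ := hμ
  rcases Nat.eq_zero_or_pos n with rfl | hn
  · simp [h0, h1, Measure.dirac_prod_dirac]
  · rw [hrec (n + 1) (by omega),
      Finset.Nat.sum_antidiagonal_eq_sum_range_succ_mk, Finset.range_eq_Ico,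
      Finset.sum_Ico_eq_sum_range]
    congr 1
    symm
    refine Finset.sum_bij' (fun k _ => k + 1) (fun u _ => u - 1) ?_ ?_ ?_ ?_ ?_
    · intro a ha; simp at ha ⊢; omega
    · intro a ha; simp at ha ⊢; omega
    · intro a ha; simp
    · intro a ha; simp at ha ⊢; omega
    · intro a ha
      rw [mconvZ_eq_map_prod, Measure.map_map (by fun_prop) (by fun_prop)]
      simp [Function.comp_def]

lemma ae_abs_le {μ : ℕ → Measure ℤ} (hμ : IsQuicksortLaw μ)
    (n : ℕ) : ∀ᵐ k ∂μ n, |k| ≤ (n : ℤ) ^ 2 := by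
  induction n using Nat.strong_induction_on with
  | _ n ih =>
    rcases n with _ | n
    · rw [hμ.2.1, ae_dirac_iff (by measurability)]; simp
    · have := hμ.1
      rw [hμ.law_succ n]
      refine Measure.ae_smul_measure ?_ _
      rw [ae_finsetSum_measure_iff]
      intro p hp
      rw [Finset.HasAntidiagonal.mem_antidiagonal] at hp
      rw [ae_map_iff (by fun_prop) (by measurability)]
      have h1 := Measure.quasiMeasurePreserving_fst (μ := μ p.1) (ν := μ p.2) |>.ae
        (ih p.1 (by omega))
      have h2 := Measure.quasiMeasurePreserving_snd (μ := μ p.1) (ν := μ p.2) |>.ae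
        (ih p.2 (by omega))
      filter_upwards [h1, h2] with x hx1 hx2
      have h3 := abs_add_three x.1 x.2 (n : ℤ)
      have h4 : |(n : ℤ)| = n := by simp
      have h5 : (n : ℤ) = p.1 + p.2 := by exact_mod_cast hp.symm
      push_cast
      nlinarith [mul_nonneg (Int.natCast_nonneg p.1) (Int.natCast_nonneg p.2)]

lemma integrable {μ : ℕ → Measure ℤ} (hμ : IsQuicksortLaw μ)
    {E : Type*} [NormedAddCommGroup E] (n : ℕ) (g : ℤ → E) :
    Integrable g (μ n) := by
  have := hμ.1 n
  refine Integrable.of_bound (StronglyMeasurable.of_discrete).aestronglyMeasurable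
    (∑ k ∈ Finset.Icc (-(n : ℤ) ^ 2) ((n : ℤ) ^ 2), ‖g k‖) ?_
  filter_upwards [hμ.ae_abs_le n] with k hk
  refine Finset.single_le_sum (f := fun k => ‖g k‖) (fun _ _ => norm_nonneg _) ?_
  rw [Finset.mem_Icc, neg_le]
  exact ⟨(neg_le_abs k).trans hk, (le_abs_self k).trans hk⟩

lemma integral_succ {μ : ℕ → Measure ℤ} (hμ : IsQuicksortLaw μ)
    {E : Type*} [NormedAddCommGroup E] [NormedSpace ℝ E] (n : ℕ)
    (g : ℤ → E) :
    ((n : ℝ) + 1) • ∫ k, g k ∂μ (n + 1) = ∑ p ∈ antidiagonal n,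
      ∫ a, ∫ b, g (a + b + n) ∂μ p.2 ∂μ p.1 := by
  have := hμ.1
  have h_int := hμ.integrable (n + 1) g
  rw [hμ.law_succ n] at h_int ⊢
  have hn : ((n + 1 : ℕ) : ENNReal)⁻¹ ≠ 0 := by simp
  have hn' : ((n + 1 : ℕ) : ENNReal)⁻¹ ≠ ⊤ := by simp
  rw [integrable_smul_measure hn hn', integrable_finsetSum_measure] at h_int
  rw [integral_smul_measure, integral_finsetSum_measure h_int, smul_smul]
  have h1 : ((n : ℝ) + 1) * ((n + 1 : ℕ) : ENNReal)⁻¹.toReal = 1 := by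
    rw [ENNReal.toReal_inv, ENNReal.toReal_natCast]; push_cast; field_simp
  rw [h1, one_smul]
  refine Finset.sum_congr rfl fun p hp => ?_
  have h2 := h_int p hp
  rw [integral_map (by fun_prop) (StronglyMeasurable.of_discrete).aestronglyMeasurable,
    integral_prod]
  exact (integrable_map_measure (StronglyMeasurable.of_discrete).aestronglyMeasurable
    (by fun_prop)).1 h2

end IsQuicksortLaw

section HarmonicConvolution

open Finset.HasAntidiagonal (antidiagonal)

/-- Generalized harmonic numbers of order two. -/
noncomputable def harmonicSq (n : ℕ) : ℝ := ∑ i ∈ Finset.range n, 1 / ((i : ℝ) + 1) ^ 2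

lemma harmonicSq_succ (n : ℕ) : harmonicSq (n + 1) = harmonicSq n + 1 / ((n : ℝ) + 1) ^ 2 := by
  rw [harmonicSq, Finset.sum_range_succ, harmonicSq]

lemma harmonic_cast_succ (n : ℕ) :
    ((harmonic (n + 1) : ℚ) : ℝ) = (harmonic n : ℚ) + 1 / ((n : ℝ) + 1) := by
  rw [harmonic_succ]; push_cast; rw [one_div]

lemma sum_antidiagonal_fst {M : Type*} [AddCommMonoid M] (f : ℕ → M) (n : ℕ) :
    ∑ p ∈ antidiagonal n, f p.1 = ∑ i ∈ Finset.range (n + 1), f i := by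
  rw [Finset.Nat.sum_antidiagonal_eq_sum_range_succ_mk]

lemma sum_antidiagonal_snd {M : Type*} [AddCommMonoid M] (f : ℕ → M) (n : ℕ) :
    ∑ p ∈ antidiagonal n, f p.2 = ∑ i ∈ Finset.range (n + 1), f i := by
  rw [← sum_antidiagonal_fst, ← Finset.Nat.sum_antidiagonal_swap]
  simp

lemma eq_harmonic_of_step {q : ℕ → ℝ} (h0 : q 0 = 0)
    (hq : ∀ n : ℕ, ((n : ℝ) + 1) * q (n + 1) = (n + 2) * q n + 2 * n)
    (n : ℕ) : q n = 2 * (n + 1) * (harmonic n : ℚ) - 4 * n := by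
  induction n with
  | zero => simp [h0]
  | succ n ih =>
    have hn : (n : ℝ) + 1 ≠ 0 := by positivity
    apply mul_left_cancel₀ hn
    rw [hq, ih, harmonic_cast_succ]
    push_cast
    field_simp
    ring

lemma sum_range_of_step {q : ℕ → ℝ} (h0 : q 0 = 0)
    (hq : ∀ n : ℕ, ((n : ℝ) + 1) * q (n + 1) = (n + 2) * q n + 2 * n)
    (n : ℕ) :
    2 * ∑ i ∈ Finset.range (n + 1), q i = (n + 1) * q (n + 1) - n * (n + 1) := by
  induction n with
  | zero => have := hq 0; simp [h0] at *; exact this.symm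
  | succ n ih =>
    rw [Finset.sum_range_succ, mul_add, ih]
    have := hq (n + 1)
    push_cast at *
    linarith

lemma sum_mul_antidiagonal {q : ℕ → ℝ} (h0 : q 0 = 0)
    (hq : ∀ n : ℕ, ((n : ℝ) + 1) * q (n + 1) = (n + 2) * q n + 2 * n)
    (n : ℕ) :
    ∑ p ∈ antidiagonal n, (p.1 : ℝ) * q p.2 =
      (-17 * n ^ 3 - 21 * n ^ 2 + 2 * n) / 18 +
        (harmonic n : ℚ) * (n ^ 3 / 3 + n ^ 2 + 2 * n / 3) := by
  induction n with
  | zero => simp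
  | succ n ih =>
    have h1 := sum_range_of_step h0 hq n
    rw [← sum_antidiagonal_snd] at h1
    have hn : (n : ℝ) + 1 ≠ 0 := by positivity
    rw [Finset.Nat.sum_antidiagonal_succ]
    simp only [Nat.cast_add, Nat.cast_one, add_mul, one_mul, Finset.sum_add_distrib, ih]
    rw [hq n, eq_harmonic_of_step h0 hq n] at h1
    have h2 : ∑ p ∈ antidiagonal n, q p.2 =
      ((n + 2) * (2 * (n + 1) * (harmonic n : ℚ) - 4 * n) + 2 * n - n * (n + 1)) / 2 := by linarith
    rw [h2, harmonic_cast_succ]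
    push_cast
    field_simp
    ring

lemma sum_conv_antidiagonal_step {q : ℕ → ℝ}
    (hq : ∀ n : ℕ, ((n : ℝ) + 1) * q (n + 1) = (n + 2) * q n + 2 * n)
    (n : ℕ) :
    ((n : ℝ) + 1) * ∑ p ∈ antidiagonal (n + 1), q p.1 * q p.2 =
      (n + 4) * ∑ p ∈ antidiagonal n, q p.1 * q p.2 +
        4 * ∑ p ∈ antidiagonal n, (p.1 : ℝ) * q p.2 := by
  have key (m : ℕ) : (m : ℝ) * ∑ p ∈ antidiagonal m, q p.1 * q p.2 =
      2 * ∑ p ∈ antidiagonal m, (p.1 : ℝ) * q p.1 * q p.2 := by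
    have h1 : ∑ p ∈ antidiagonal m, (p.1 : ℝ) * q p.1 * q p.2 =
        ∑ p ∈ antidiagonal m, (p.2 : ℝ) * q p.1 * q p.2 := by
      rw [← Finset.Nat.sum_antidiagonal_swap]
      exact Finset.sum_congr rfl fun p _ => by simp; ring
    rw [two_mul]
    nth_rewrite 2 [h1]
    rw [← Finset.sum_add_distrib, Finset.mul_sum]
    refine Finset.sum_congr rfl fun p hp => ?_
    rw [Finset.HasAntidiagonal.mem_antidiagonal] at hp
    rw [← hp]; push_cast; ring
  have h1 := key (n + 1)
  rw [Finset.Nat.sum_antidiagonal_succ (f := fun p => (p.1 : ℝ) * q p.1 * q p.2)] at h1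
  push_cast at h1
  rw [h1]
  have h2 : ∀ p ∈ antidiagonal n, ((p.1 : ℝ) + 1) * q (p.1 + 1) * q p.2 =
      p.1 * q p.1 * q p.2 + 2 * (q p.1 * q p.2) + 2 * (p.1 * q p.2) := fun p _ => by
    rw [hq]; ring
  rw [Finset.sum_congr rfl h2, Finset.sum_add_distrib, Finset.sum_add_distrib,
    ← Finset.mul_sum, ← Finset.mul_sum]
  linear_combination -key n

lemma sum_conv_antidiagonal {q : ℕ → ℝ} (h0 : q 0 = 0)
    (hq : ∀ n : ℕ, ((n : ℝ) + 1) * q (n + 1) = (n + 2) * q n + 2 * n)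
    (n : ℕ) :
    ∑ p ∈ antidiagonal n, q p.1 * q p.2 =
      (169 * n ^ 3 + 438 * n ^ 2 + 257 * n) / 27 +
        (harmonic n : ℚ) * (-34 * n ^ 3 - 132 * n ^ 2 - 122 * n) / 9 +
        ((harmonic n : ℚ) ^ 2 - harmonicSq n) *
          (2 * n ^ 3 / 3 + 4 * n ^ 2 + 22 * n / 3 + 4) := by
  induction n with
  | zero => simp [h0, harmonicSq]
  | succ n ih =>
    have hn : (n : ℝ) + 1 ≠ 0 := by positivity
    apply mul_left_cancel₀ hn
    rw [sum_conv_antidiagonal_step hq, ih, sum_mul_antidiagonal h0 hq, harmonic_cast_succ,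
      harmonicSq_succ]
    push_cast
    field_simp
    ring

end HarmonicConvolution

namespace IsQuicksortLaw

open Finset.HasAntidiagonal (antidiagonal)

lemma mean_zero {μ : ℕ → Measure ℤ} (hμ : IsQuicksortLaw μ) : meanZ (μ 0) = 0 := by
  rw [meanZ, hμ.2.1, integral_dirac]; simp

lemma mean_step {μ : ℕ → Measure ℤ} (hμ : IsQuicksortLaw μ) (n : ℕ) :
    ((n : ℝ) + 1) * meanZ (μ (n + 1)) = (n + 2) * meanZ (μ n) + 2 * n := by
  have := hμ.1
  have key (n : ℕ) : ((n : ℝ) + 1) * meanZ (μ (n + 1)) =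
      n * (n + 1) + 2 * ∑ i ∈ Finset.range (n + 1), meanZ (μ i) := by
    have h := hμ.integral_succ n (fun k => (k : ℝ))
    have h2 (p : ℕ × ℕ) : ∫ a, ∫ b, ((a + b + (n : ℤ) : ℤ) : ℝ) ∂μ p.2 ∂μ p.1 =
        meanZ (μ p.1) + meanZ (μ p.2) + n := by
      push_cast
      simp_rw [integral_add (hμ.integrable _ _) (hμ.integrable _ _)]
      simp [meanZ]
    simp_rw [h2, Finset.sum_add_distrib] at h
    rw [sum_antidiagonal_fst (fun i => meanZ (μ i)),
      sum_antidiagonal_snd (fun i => meanZ (μ i))] at h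
    simp only [smul_eq_mul, Finset.sum_const, Finset.Nat.card_antidiagonal, nsmul_eq_mul] at h
    rw [meanZ, h]; push_cast; ring
  rcases n with _ | n
  · rw [key]; simp [hμ.mean_zero]
  · have h1 := key n
    have h2 := key (n + 1)
    rw [Finset.sum_range_succ] at h2
    push_cast at *
    linarith

lemma mean_eq {μ : ℕ → Measure ℤ} (hμ : IsQuicksortLaw μ)
    (n : ℕ) : meanZ (μ n) = 2 * (n + 1) * (harmonic n : ℚ) - 4 * n :=
  eq_harmonic_of_step (q := fun i => meanZ (μ i)) hμ.mean_zero hμ.mean_step n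

lemma secondMoment_succ {μ : ℕ → Measure ℤ} (hμ : IsQuicksortLaw μ) (n : ℕ) :
    ((n : ℝ) + 1) * ∫ k, (k : ℝ) ^ 2 ∂μ (n + 1) =
      2 * ∑ i ∈ Finset.range (n + 1), ∫ k, (k : ℝ) ^ 2 ∂μ i + n ^ 2 * (n + 1) +
        2 * n * ((n + 1) * meanZ (μ (n + 1)) - n * (n + 1)) +
        2 * ∑ p ∈ antidiagonal n, meanZ (μ p.1) * meanZ (μ p.2) := by
  have := hμ.1
  have h := hμ.integral_succ n (fun k => (k : ℝ) ^ 2)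
  have h2 (p : ℕ × ℕ) : ∫ a, ∫ b, ((a + b + (n : ℤ) : ℤ) : ℝ) ^ 2 ∂μ p.2 ∂μ p.1 =
      ∫ k, (k : ℝ) ^ 2 ∂μ p.1 + ∫ k, (k : ℝ) ^ 2 ∂μ p.2 + n ^ 2
        + 2 * n * meanZ (μ p.1) + 2 * n * meanZ (μ p.2)
        + 2 * (meanZ (μ p.1) * meanZ (μ p.2)) := by
    have e1 (a b : ℤ) : ((a + b + (n : ℤ) : ℤ) : ℝ) ^ 2 =
      (a : ℝ) ^ 2 + (b : ℝ) ^ 2 + (n : ℝ) ^ 2 + 2 * n * a + 2 * n * b + 2 * a * b := by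
      push_cast; ring
    simp_rw [e1, integral_add (hμ.integrable _ _) (hμ.integrable _ _), integral_const_mul,
      mul_assoc, integral_const_mul, integral_mul_const]
    simp [meanZ]
  simp_rw [h2, Finset.sum_add_distrib, ← Finset.mul_sum] at h
  rw [sum_antidiagonal_fst (fun i => meanZ (μ i)), sum_antidiagonal_snd (fun i => meanZ (μ i)),
    sum_antidiagonal_fst (fun i => ∫ k, (k : ℝ) ^ 2 ∂μ i),
    sum_antidiagonal_snd (fun i => ∫ k, (k : ℝ) ^ 2 ∂μ i)] at h
  simp only [smul_eq_mul, Finset.sum_const, Finset.Nat.card_antidiagonal, nsmul_eq_mul] at h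
  have h3 := sum_range_of_step (q := fun i => meanZ (μ i)) hμ.mean_zero hμ.mean_step n
  rw [h, ← h3]; push_cast; ring

lemma secondMoment_eq {μ : ℕ → Measure ℤ} (hμ : IsQuicksortLaw μ) (n : ℕ) :
    ∫ k, (k : ℝ) ^ 2 ∂μ n = 7 * n ^ 2 - 4 * (n + 1) ^ 2 * harmonicSq n
      - 2 * (n + 1) * (harmonic n : ℚ) + 13 * n
      + (2 * (n + 1) * (harmonic n : ℚ) - 4 * n) ^ 2 := by
  induction n with
  | zero => simp [hμ.2.1, harmonicSq]
  | succ n ih =>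
    rcases n with _ | n
    · simp [hμ.2.2.1, harmonicSq]; norm_num
    · have h1 := hμ.secondMoment_succ n
      have h2 := hμ.secondMoment_succ (n + 1)
      rw [Finset.sum_range_succ, sum_conv_antidiagonal (q := fun i => meanZ (μ i)) hμ.mean_zero
        hμ.mean_step, mean_eq hμ] at h2
      rw [sum_conv_antidiagonal (q := fun i => meanZ (μ i)) hμ.mean_zero hμ.mean_step,
        mean_eq hμ] at h1
      rw [ih] at h1 h2
      have hn : (((n + 1 : ℕ) : ℝ) + 1) ≠ 0 := by positivity
      apply mul_left_cancel₀ hn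
      rw [h2]
      generalize ∑ i ∈ Finset.range (n + 1), ∫ k, (k : ℝ) ^ 2 ∂μ i = S at *
      simp only [harmonic_cast_succ, harmonicSq_succ] at *
      push_cast at *
      have hS : 2 * S = _ := eq_sub_of_add_eq (eq_sub_of_add_eq (eq_sub_of_add_eq h1.symm))
      rw [mul_add 2 S, hS]
      have hn1 : (n : ℝ) + 1 ≠ 0 := by positivity
      have hn2 : (n : ℝ) + 1 + 1 ≠ 0 := by positivity
      field_simp
      ring

/-- The variance of `Q_n / (n + 1)`. -/
lemma variance_eq {μ : ℕ → Measure ℤ} (hμ : IsQuicksortLaw μ) (n : ℕ) :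
    ∫ k, (((k : ℝ) - meanZ (μ n)) / (n + 1)) ^ 2 ∂μ n =
      (7 * n ^ 2 + 13 * n) / (n + 1) ^ 2 - 4 * harmonicSq n
        - 2 * (harmonic n : ℚ) / (n + 1) := by
  have := hμ.1
  have e1 (k : ℤ) : (((k : ℝ) - meanZ (μ n)) / (n + 1)) ^ 2 =
      ((k : ℝ) ^ 2 + ((-2 * meanZ (μ n)) * k + meanZ (μ n) ^ 2)) / (n + 1) ^ 2 := by
    rw [div_pow]; ring
  simp_rw [e1, integral_div, integral_add (hμ.integrable _ _) (hμ.integrable _ _),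
    integral_const_mul, hμ.secondMoment_eq]
  have : ∫ k, (k : ℝ) ∂μ n = meanZ (μ n) := rfl
  rw [this, hμ.mean_eq]
  simp
  field_simp
  ring

lemma integrable_prod {μ : ℕ → Measure ℤ} (hμ : IsQuicksortLaw μ) {E : Type*}
    [NormedAddCommGroup E] (i j : ℕ) (g : ℤ × ℤ → E) : Integrable g ((μ i).prod (μ j)) := by
  have := hμ.1
  rw [MeasureTheory.integrable_prod_iff (StronglyMeasurable.of_discrete).aestronglyMeasurable]
  exact ⟨Eventually.of_forall fun x => hμ.integrable _ _, hμ.integrable _ _⟩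

/-- `(Q_n - q_n) / (n + 1)` increases in the convex order. -/
lemma integral_convex_le_succ {μ : ℕ → Measure ℤ} (hμ : IsQuicksortLaw μ) (n : ℕ) (g : ℝ → ℝ)
    (hg : ConvexOn ℝ Set.univ g) :
    ∫ k, g (((k : ℝ) - meanZ (μ n)) / ((n : ℝ) + 1)) ∂μ n ≤
      ∫ k, g (((k : ℝ) - meanZ (μ (n + 1))) / ((n : ℝ) + 2)) ∂μ (n + 1) := by
  have := hμ.1
  induction n using Nat.strong_induction_on generalizing g with
  | _ n ih =>
    rcases n with _ | n
    · have h1 : meanZ (μ 1) = 0 := by rw [meanZ, hμ.2.2.1, integral_dirac]; simp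
      rw [zero_add, hμ.mean_zero, h1, hμ.2.1, hμ.2.2.1]
      simp
    · set q : ℕ → ℝ := fun i => meanZ (μ i) with hq
      have hqs : ∀ n : ℕ, ((n : ℝ) + 1) * q (n + 1) = (n + 2) * q n + 2 * n := hμ.mean_step
      let G : ℕ → ℕ → ℝ := fun i j =>
        ∫ a, ∫ b, g (((a : ℝ) + b + (n + 1) - q (n + 2)) / (n + 3)) ∂μ j ∂μ i
      have hn3 : (n : ℝ) + 3 ≠ 0 := by positivity
      have hn2 : (n : ℝ) + 2 ≠ 0 := by positivity
      have swap (i j : ℕ) (F : ℤ → ℤ → ℝ) :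
          ∫ a, ∫ b, F a b ∂μ j ∂μ i = ∫ b, ∫ a, F a b ∂μ i ∂μ j :=
        integral_integral_swap (hμ.integrable_prod i j (fun p => F p.1 p.2))
      have hG1 : ∀ i j : ℕ, i ≤ n →
          ∫ a, ∫ b, g ((q (i + 1) + ((a : ℝ) - q i) * (i + 2) / (i + 1) + b + (n + 1)
            - q (n + 2)) / (n + 3)) ∂μ j ∂μ i ≤ G (i + 1) j := by
        intro i j hi
        rw [swap i j]
        refine le_trans ?_ (swap (i + 1) j _).ge
        refine integral_mono (hμ.integrable _ _) (hμ.integrable _ _) fun b => ?_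
        have h := ih i (by omega) (fun y => g (((i + 2) / (n + 3)) * y +
          (q (i + 1) + b + (n + 1) - q (n + 2)) / (n + 3))) (by
            refine ⟨convex_univ, fun x _ y _ s t hs ht hst => ?_⟩
            refine le_trans (le_of_eq ?_) (hg.2 (Set.mem_univ _) (Set.mem_univ _) hs ht hst)
            simp only [smul_eq_mul]
            congr 1
            rw [eq_sub_of_add_eq' hst]
            ring)
        convert! h using 4 with a a
        · have : (i : ℝ) + 1 ≠ 0 := by positivity
          simp only [hq]; field_simp; ring
        · have : (i : ℝ) + 2 ≠ 0 := by positivity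
          simp only [hq]; field_simp; ring
      have hG2 : ∀ i j : ℕ, j ≤ n →
          ∫ a, ∫ b, g (((a : ℝ) + (q (j + 1) + ((b : ℝ) - q j) * (j + 2) / (j + 1)) + (n + 1)
            - q (n + 2)) / (n + 3)) ∂μ j ∂μ i ≤ G i (j + 1) := by
        intro i j hj
        rw [swap i j]
        refine (le_of_eq ?_).trans ((hG1 j i hj).trans (le_of_eq ((swap (j + 1) i _).trans ?_))) <;>
        · congr 1; ext a; congr 1; ext b; congr 2; ring
      have hkey : ∀ p ∈ antidiagonal n,
          ∫ a, ∫ b, g ((((a + b + (n : ℤ) : ℤ) : ℝ) - q (n + 1)) / (n + 2)) ∂μ p.2 ∂μ p.1 ≤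
            ((p.1 : ℝ) + 1) / (n + 2) * G (p.1 + 1) p.2 +
              ((p.2 : ℝ) + 1) / (n + 2) * G p.1 (p.2 + 1) := by
        rintro ⟨i, j⟩ hp
        rw [Finset.HasAntidiagonal.mem_antidiagonal] at hp
        simp only at hp ⊢
        have hij : (n : ℝ) = i + j := by exact_mod_cast hp.symm
        have hi1 : (i : ℝ) + 1 ≠ 0 := by positivity
        have hj1 : (j : ℝ) + 1 ≠ 0 := by positivity
        refine le_trans ?_ (add_le_add
          (mul_le_mul_of_nonneg_left (hG1 i j (by omega)) (by positivity))
          (mul_le_mul_of_nonneg_left (hG2 i j (by omega)) (by positivity)))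
        simp_rw [← integral_const_mul]
        rw [← integral_add (hμ.integrable _ _) (hμ.integrable _ _)]
        refine integral_mono (hμ.integrable _ _) (hμ.integrable _ _) fun a => ?_
        simp only
        rw [← integral_add (hμ.integrable _ _) (hμ.integrable _ _)]
        refine integral_mono (hμ.integrable _ _) (hμ.integrable _ _) fun b => ?_
        refine le_trans (le_of_eq ?_) (hg.2 (Set.mem_univ _) (Set.mem_univ _)
          (by positivity : (0 : ℝ) ≤ ((i : ℝ) + 1) / (n + 2))
          (by positivity : (0 : ℝ) ≤ ((j : ℝ) + 1) / (n + 2)) (by field_simp; rw [hij]; ring))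
        congr 1
        have e1 := hqs i
        have e2 := hqs j
        have e3 := hqs (n + 1)
        push_cast at e3
        have e1' : q (i + 1) = ((i + 2) * q i + 2 * i) / (i + 1) := by
          rw [eq_div_iff hi1]; linarith
        have e2' : q (j + 1) = ((j + 2) * q j + 2 * j) / (j + 1) := by
          rw [eq_div_iff hj1]; linarith
        have e3' : q (n + 2) = ((n + 3) * q (n + 1) + 2 * (n + 1)) / (n + 2) := by
          rw [eq_div_iff hn2]; linarith
        rw [e1', e2', e3']
        push_cast
        simp only [smul_eq_mul]
        rw [hij] at hn2 hn3 ⊢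
        field_simp
        ring
      have e := hμ.integral_succ n (fun k => g (((k : ℝ) - q (n + 1)) / (n + 2)))
      have e' := hμ.integral_succ (n + 1) (fun k => g (((k : ℝ) - q (n + 2)) / (n + 3)))
      have hG : ∑ p ∈ antidiagonal (n + 1), G p.1 p.2 =
          ((n : ℝ) + 2) * ∫ k, g (((k : ℝ) - q (n + 2)) / (n + 3)) ∂μ (n + 2) := by
        push_cast [smul_eq_mul] at e'
        rw [show (n : ℝ) + 2 = n + 1 + 1 by ring, e']
      have hS : ∑ p ∈ antidiagonal n, (((p.1 : ℝ) + 1) / (n + 2) * G (p.1 + 1) p.2 +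
          ((p.2 : ℝ) + 1) / (n + 2) * G p.1 (p.2 + 1)) =
          ((n : ℝ) + 1) / (n + 2) * ∑ p ∈ antidiagonal (n + 1), G p.1 p.2 := by
        have s1 := Finset.Nat.sum_antidiagonal_succ (n := n)
          (f := fun p => (p.1 : ℝ) / (n + 2) * G p.1 p.2)
        have s2 := Finset.Nat.sum_antidiagonal_succ' (n := n)
          (f := fun p => (p.2 : ℝ) / (n + 2) * G p.1 p.2)
        push_cast at s1 s2
        rw [Finset.sum_add_distrib]
        simp only [zero_div, zero_mul, zero_add] at s1 s2
        rw [← s1, ← s2, ← Finset.sum_add_distrib, Finset.mul_sum]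
        refine Finset.sum_congr rfl fun p hp => ?_
        rw [Finset.HasAntidiagonal.mem_antidiagonal] at hp
        have : (n : ℝ) + 1 = p.1 + p.2 := by exact_mod_cast hp.symm
        rw [this]; ring
      have hfin := Finset.sum_le_sum hkey
      rw [hS, hG] at hfin
      rw [smul_eq_mul] at e
      rw [← e] at hfin
      have hn1 : (0 : ℝ) < (n : ℝ) + 1 := by positivity
      have hfin2 : ∫ k, g (((k : ℝ) - q (n + 1)) / (n + 2)) ∂μ (n + 1) ≤
          ∫ k, g (((k : ℝ) - q (n + 2)) / (n + 3)) ∂μ (n + 2) := by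
        refine le_of_mul_le_mul_left (hfin.trans (le_of_eq ?_)) hn1
        field_simp
      convert! hfin2 using 5 <;> push_cast <;> ring

lemma integral_convex_mono {μ : ℕ → Measure ℤ} (hμ : IsQuicksortLaw μ) (g : ℝ → ℝ)
    (hg : ConvexOn ℝ Set.univ g) :
    Monotone fun n => ∫ k, g (((k : ℝ) - meanZ (μ n)) / ((n : ℝ) + 1)) ∂μ n := by
  refine monotone_nat_of_le_succ fun n => (hμ.integral_convex_le_succ n g hg).trans_eq ?_
  push_cast
  rw [show (n : ℝ) + 1 + 1 = n + 2 by ring]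

end IsQuicksortLaw

/-- The characteristic function of a law on `ℤ`, centered at its mean. -/
noncomputable def centeredCharFun (ν : Measure ℤ) (t : ℝ) : ℂ :=
  ∫ k, Complex.exp ((t * ((k : ℝ) - meanZ ν) : ℝ) * Complex.I) ∂ν

lemma convexOn_sq_div_two_add_cos (s θ : ℝ) :
    ConvexOn ℝ Set.univ fun y : ℝ => (s * y) ^ 2 / 2 + Real.cos (s * y + θ) := by
  have hd (y : ℝ) : HasDerivAt (fun y : ℝ => (s * y) ^ 2 / 2 + Real.cos (s * y + θ))
      (s ^ 2 * y - s * Real.sin (s * y + θ)) y := by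
    have h1 : HasDerivAt (fun y : ℝ => s * y) s y := by
      simpa using (hasDerivAt_id y).const_mul s
    convert! ((h1.pow 2).div_const 2).add (h1.add_const θ).cos using 1
    simp; ring
  have hd2 (y : ℝ) : HasDerivAt (fun y : ℝ => s ^ 2 * y - s * Real.sin (s * y + θ))
      (s ^ 2 - s ^ 2 * Real.cos (s * y + θ)) y := by
    have h1 : HasDerivAt (fun y : ℝ => s * y) s y := by
      simpa using (hasDerivAt_id y).const_mul s
    convert! ((hasDerivAt_id y).const_mul (s ^ 2)).sub ((h1.add_const θ).sin.const_mul s) using 1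
    simp; ring
  have e1 : deriv (fun y : ℝ => (s * y) ^ 2 / 2 + Real.cos (s * y + θ)) =
      fun y => s ^ 2 * y - s * Real.sin (s * y + θ) := funext fun y => (hd y).deriv
  refine convexOn_univ_of_deriv2_nonneg (fun y => (hd y).differentiableAt) ?_ fun y => ?_
  · rw [e1]; exact fun y => (hd2 y).differentiableAt
  · rw [Function.iterate_succ, Function.iterate_one, Function.comp, e1, (hd2 y).deriv]
    nlinarith [Real.cos_le_one (s * y + θ), sq_nonneg s]

namespace IsQuicksortLaw

lemma norm_centeredCharFun_le_one {μ : ℕ → Measure ℤ} (hμ : IsQuicksortLaw μ) (n : ℕ) (t : ℝ) :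
    ‖centeredCharFun (μ n) t‖ ≤ 1 := by
  have := hμ.1 n
  refine (norm_integral_le_integral_norm _).trans ?_
  simp only [Complex.norm_exp_ofReal_mul_I]
  simp

/-- The variance of `Q_n / (n + 1)`. -/
noncomputable def scaledVar (μ : ℕ → Measure ℤ) (n : ℕ) : ℝ :=
  ∫ k, (((k : ℝ) - meanZ (μ n)) / (n + 1)) ^ 2 ∂μ n

lemma scaledVar_mono {μ : ℕ → Measure ℤ} (hμ : IsQuicksortLaw μ) : Monotone (scaledVar μ) :=
  hμ.integral_convex_mono (fun y => y ^ 2) (even_two.convexOn_pow)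

lemma norm_centeredCharFun_sub_le {μ : ℕ → Measure ℤ} (hμ : IsQuicksortLaw μ) {n m : ℕ}
    (hnm : n ≤ m) (s : ℝ) :
    ‖centeredCharFun (μ n) (s / (n + 1)) - centeredCharFun (μ m) (s / (m + 1))‖ ≤
      s ^ 2 / 2 * (scaledVar μ m - scaledVar μ n) := by
  set z := centeredCharFun (μ n) (s / (n + 1)) - centeredCharFun (μ m) (s / (m + 1)) with hz
  set θ := -z.arg with hθ
  have h1 : (‖z‖ : ℂ) = Complex.exp (θ * Complex.I) * z := by
    conv_rhs => rw [← Complex.norm_mul_exp_arg_mul_I z]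
    rw [mul_left_comm, ← Complex.exp_add, hθ]
    simp
  have h2 (i : ℕ) : (Complex.exp (θ * Complex.I) * centeredCharFun (μ i) (s / (i + 1))).re =
      ∫ k, Real.cos (s * (((k : ℝ) - meanZ (μ i)) / (i + 1)) + θ) ∂μ i := by
    rw [centeredCharFun, ← integral_const_mul]
    have h3 := integral_re (𝕜 := ℂ) (hμ.integrable i fun k : ℤ => Complex.exp (θ * Complex.I) *
      Complex.exp ((s / (i + 1) * ((k : ℝ) - meanZ (μ i)) : ℝ) * Complex.I))
    refine h3.symm.trans (integral_congr_ae (.of_forall fun k => ?_))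
    simp only
    rw [← Complex.exp_add, ← add_mul, ← Complex.ofReal_add]
    refine (Complex.exp_ofReal_mul_I_re _).trans ?_
    congr 1; ring
  have h3 := hμ.integral_convex_mono _ (convexOn_sq_div_two_add_cos s θ) hnm
  simp only [mul_pow, mul_div_assoc] at h3
  rw [integral_add (hμ.integrable _ _) (hμ.integrable _ _),
    integral_add (hμ.integrable _ _) (hμ.integrable _ _), integral_const_mul, integral_const_mul,
    integral_div, integral_div, ← h2, ← h2] at h3
  have h4 : ‖z‖ = (Complex.exp (θ * Complex.I) * z).re := by
    rw [← h1, Complex.ofReal_re]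
  rw [h4, hz, mul_sub, Complex.sub_re]
  rw [scaledVar, scaledVar]
  linarith

lemma scaledVar_le {μ : ℕ → Measure ℤ} (hμ : IsQuicksortLaw μ) (n : ℕ) : scaledVar μ n ≤ 13 := by
  rw [scaledVar, hμ.variance_eq]
  have h1 : 0 ≤ harmonicSq n := Finset.sum_nonneg fun _ _ => by positivity
  have h2 : (0 : ℝ) ≤ (harmonic n : ℚ) := by
    rw [harmonic]; push_cast; exact Finset.sum_nonneg fun _ _ => by positivity
  have h3 : (7 * (n : ℝ) ^ 2 + 13 * n) / (n + 1) ^ 2 ≤ 13 := by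
    rw [div_le_iff₀ (by positivity)]; nlinarith [sq_nonneg (n : ℝ), Nat.cast_nonneg (α := ℝ) n]
  have h4 : 0 ≤ 2 * ((harmonic n : ℚ) : ℝ) / (n + 1) := by positivity
  linarith

lemma harmonic_le_two_sqrt (n : ℕ) : ((harmonic n : ℚ) : ℝ) ≤ 2 * √(n : ℝ) := by
  induction n with
  | zero => simp
  | succ n ih =>
    rw [harmonic_cast_succ]
    refine (add_le_add_left ih _).trans ?_
    push_cast
    have h1 := Real.sq_sqrt (Nat.cast_nonneg (α := ℝ) n)
    have h2 := Real.sq_sqrt (by positivity : (0 : ℝ) ≤ n + 1)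
    have h3 : √(n : ℝ) ≤ √((n : ℝ) + 1) := Real.sqrt_le_sqrt (by linarith)
    have h4 : 1 ≤ √((n : ℝ) + 1) := Real.one_le_sqrt.2 (by linarith [Nat.cast_nonneg (α := ℝ) n])
    have h5 : 1 / ((n : ℝ) + 1) ≤ 1 / √((n : ℝ) + 1) := by
      apply one_div_le_one_div_of_le (by positivity); nlinarith
    have h6 : 1 / √((n : ℝ) + 1) ≤ 2 * √((n : ℝ) + 1) - 2 * √(n : ℝ) := by
      rw [div_le_iff₀ (by positivity)]
      nlinarith [Real.sqrt_nonneg (n : ℝ)]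
    linarith

lemma scaledVar_sub_le {μ : ℕ → Measure ℤ} (hμ : IsQuicksortLaw μ) {n m : ℕ} (hnm : n ≤ m) :
    scaledVar μ m - scaledVar μ n ≤ 40 / √((n : ℝ) + 1) := by
  simp only [scaledVar, hμ.variance_eq]
  have h1 : harmonicSq n ≤ harmonicSq m :=
    Finset.sum_le_sum_of_subset_of_nonneg (by simpa using hnm) fun _ _ _ => by positivity
  have h2 : (0 : ℝ) ≤ (harmonic m : ℚ) := by
    rw [harmonic]; push_cast; exact Finset.sum_nonneg fun _ _ => by positivity
  have h4 : 0 ≤ 2 * ((harmonic m : ℚ) : ℝ) / (m + 1) := by positivity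
  have hs : 1 ≤ √((n : ℝ) + 1) := Real.one_le_sqrt.2 (by linarith [Nat.cast_nonneg (α := ℝ) n])
  have hsq := Real.sq_sqrt (by positivity : (0 : ℝ) ≤ n + 1)
  have hnm' : (n : ℝ) ≤ m := by exact_mod_cast hnm
  have hn0 := Nat.cast_nonneg (α := ℝ) n
  have h5 : (7 * (m : ℝ) ^ 2 + 13 * m) / (m + 1) ^ 2 ≤ 7 + 13 / (m + 1) := by
    rw [div_le_iff₀ (by positivity)]; field_simp; nlinarith
  have h6 : (13 : ℝ) / (m + 1) ≤ 13 / (n + 1) := by gcongr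
  have h7 : 7 - 14 / ((n : ℝ) + 1) ≤ (7 * (n : ℝ) ^ 2 + 13 * n) / (n + 1) ^ 2 := by
    rw [le_div_iff₀ (by positivity)]; field_simp; nlinarith
  have h8 : 2 * ((harmonic n : ℚ) : ℝ) / (n + 1) ≤ 4 / √((n : ℝ) + 1) := by
    rw [div_le_div_iff₀ (by positivity) (by positivity)]
    have := harmonic_le_two_sqrt n
    have h3 : √(n : ℝ) ≤ √((n : ℝ) + 1) := Real.sqrt_le_sqrt (by linarith)
    nlinarith
  have h9 : 1 / ((n : ℝ) + 1) ≤ 1 / √((n : ℝ) + 1) :=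
    one_div_le_one_div_of_le (by positivity) (by nlinarith)
  have e1 : 13 / ((n : ℝ) + 1) = 13 * (1 / (n + 1)) := by ring
  have e2 : 14 / ((n : ℝ) + 1) = 14 * (1 / (n + 1)) := by ring
  have e3 : 4 / √((n : ℝ) + 1) = 4 * (1 / √((n : ℝ) + 1)) := by ring
  have e4 : 40 / √((n : ℝ) + 1) = 40 * (1 / √((n : ℝ) + 1)) := by ring
  have h10 : 0 ≤ 1 / √((n : ℝ) + 1) := by positivity
  linarith

lemma lipschitz_centeredCharFun {μ : ℕ → Measure ℤ} (hμ : IsQuicksortLaw μ) (n : ℕ) (s t : ℝ) :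
    ‖centeredCharFun (μ n) (s / (n + 1)) - centeredCharFun (μ n) (t / (n + 1))‖ ≤
      7 * |s - t| := by
  have := hμ.1 n
  rw [centeredCharFun, centeredCharFun, ← integral_sub (hμ.integrable _ _) (hμ.integrable _ _)]
  refine (norm_integral_le_integral_norm _).trans ?_
  have h1 : ∀ k : ℤ, ‖Complex.exp ((s / (n + 1) * ((k : ℝ) - meanZ (μ n)) : ℝ) * Complex.I) -
      Complex.exp ((t / (n + 1) * ((k : ℝ) - meanZ (μ n)) : ℝ) * Complex.I)‖ ≤
      |s - t| / 2 * (1 + (((k : ℝ) - meanZ (μ n)) / (n + 1)) ^ 2) := by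
    intro k
    set y := ((k : ℝ) - meanZ (μ n)) / (n + 1) with hy
    have e1 : s / (n + 1) * ((k : ℝ) - meanZ (μ n)) = s * y := by rw [hy]; ring
    have e2 : t / (n + 1) * ((k : ℝ) - meanZ (μ n)) = t * y := by rw [hy]; ring
    rw [e1, e2]
    have e3 : Complex.exp ((s * y : ℝ) * Complex.I) - Complex.exp ((t * y : ℝ) * Complex.I) =
        Complex.exp ((t * y : ℝ) * Complex.I) *
          (Complex.exp (Complex.I * ((s - t) * y : ℝ)) - 1) := by
      rw [mul_sub, ← Complex.exp_add, mul_one]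
      congr 2
      push_cast; ring
    rw [e3, norm_mul, Complex.norm_exp_ofReal_mul_I, one_mul]
    refine (Real.norm_exp_I_mul_ofReal_sub_one_le).trans ?_
    rw [Real.norm_eq_abs, abs_mul]
    have h5 : |y| ≤ (1 + y ^ 2) / 2 := by nlinarith [sq_nonneg (|y| - 1), sq_abs y]
    calc |s - t| * |y| ≤ |s - t| * ((1 + y ^ 2) / 2) := by gcongr
      _ = _ := by ring
  refine (integral_mono (hμ.integrable _ _) (hμ.integrable _ _) h1).trans ?_
  rw [integral_const_mul, integral_add (hμ.integrable _ _) (hμ.integrable _ _)]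
  have h2 := hμ.scaledVar_le n
  rw [scaledVar] at h2
  simp only [integral_const, probReal_univ, smul_eq_mul, mul_one]
  nlinarith [abs_nonneg (s - t)]

lemma scaledVar_three_pos {μ : ℕ → Measure ℤ} (hμ : IsQuicksortLaw μ) : 0 < scaledVar μ 3 := by
  rw [scaledVar, hμ.variance_eq]
  simp [harmonicSq, harmonic, Finset.sum_range_succ]
  norm_num

/-- Uniform nondegeneracy at small frequencies. -/
lemma exists_norm_centeredCharFun_le {μ : ℕ → Measure ℤ} (hμ : IsQuicksortLaw μ) :
    ∃ n₀ : ℕ, ∃ s₀ > 0, ∃ c > 0, ∀ m ≥ n₀, ∀ s : ℝ, |s| ≤ s₀ →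
      ‖centeredCharFun (μ m) (s / (m + 1))‖ ≤ 1 - c * s ^ 2 := by
  have hw3 := hμ.scaledVar_three_pos
  have hlim : Tendsto (fun n : ℕ => 40 / √((n : ℝ) + 1)) atTop (nhds 0) :=
    tendsto_const_nhds.div_atTop (Real.tendsto_sqrt_atTop.comp
      (tendsto_atTop_add_const_right _ _ tendsto_natCast_atTop_atTop))
  obtain ⟨n, hn⟩ := ((hlim.eventually (gt_mem_nhds (by linarith : 0 < scaledVar μ 3 / 4))).and
    (eventually_ge_atTop 3)).exists
  have := hμ.1 n
  set w := scaledVar μ n with hw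
  have hwpos : 0 < w := hw3.trans_le (hμ.scaledVar_mono hn.2)
  have hwle : w ≤ 13 := hμ.scaledVar_le n
  set B : ℝ := (n : ℝ) ^ 2 + |meanZ (μ n)| + 1 with hB
  have hB1 : 1 ≤ B := by rw [hB]; nlinarith [abs_nonneg (meanZ (μ n)), sq_nonneg (n : ℝ)]
  have hY : ∀ᵐ k : ℤ ∂μ n, |((k : ℝ) - meanZ (μ n)) / (n + 1)| ≤ B := by
    filter_upwards [hμ.ae_abs_le n] with k hk
    have hk' : |(k : ℝ)| ≤ (n : ℝ) ^ 2 := by exact_mod_cast hk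
    rw [abs_div, abs_of_pos (by positivity : (0 : ℝ) < (n : ℝ) + 1)]
    refine (div_le_self (abs_nonneg _) (by linarith [Nat.cast_nonneg (α := ℝ) n])).trans ?_
    refine (abs_sub _ _).trans ?_
    rw [hB]; linarith
  have hmean : ∫ k : ℤ, ((k : ℝ) - meanZ (μ n)) / (n + 1) ∂μ n = 0 := by
    rw [integral_div, integral_sub (hμ.integrable _ _) (hμ.integrable _ _)]
    simp [meanZ]
  have hloc : ∀ s : ℝ, |s| * B ≤ 1 →
      ‖centeredCharFun (μ n) (s / (n + 1)) - (1 - s ^ 2 * w / 2 : ℝ)‖ ≤ |s| ^ 3 * B ^ 3 := by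
    intro s hs
    set Y : ℤ → ℝ := fun k => ((k : ℝ) - meanZ (μ n)) / (n + 1) with hYdef
    have e1 : centeredCharFun (μ n) (s / (n + 1)) - (1 - s ^ 2 * w / 2 : ℝ) =
        ∫ k, (Complex.exp ((s * Y k : ℝ) * Complex.I) -
          (1 + (s * Y k : ℝ) * Complex.I - (((s * Y k) ^ 2 / 2 : ℝ) : ℂ))) ∂μ n := by
      rw [integral_sub (hμ.integrable _ _) (hμ.integrable _ _),
        integral_sub (hμ.integrable _ _) (hμ.integrable _ _),
        integral_add (hμ.integrable _ _) (hμ.integrable _ _), integral_mul_const,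
        integral_complex_ofReal, integral_complex_ofReal, integral_const_mul, hmean, integral_div]
      simp only [mul_pow, integral_const_mul]
      have : ∫ k, Y k ^ 2 ∂μ n = w := rfl
      rw [this, centeredCharFun]
      simp [hYdef]
      congr 1; ext k; congr 1; ring
    rw [e1]
    refine (norm_integral_le_of_norm_le_const (C := |s| ^ 3 * B ^ 3) ?_).trans (by simp)
    filter_upwards [hY] with k hk
    have hsY : ‖((s * Y k : ℝ) * Complex.I : ℂ)‖ ≤ |s| * B := by
      rw [norm_mul, Complex.norm_I, mul_one, Complex.norm_real, Real.norm_eq_abs, abs_mul]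
      gcongr
    have hb := Complex.exp_bound (hsY.trans hs) (n := 3) (by norm_num)
    have e2 : ∑ m ∈ Finset.range 3, ((s * Y k : ℝ) * Complex.I : ℂ) ^ m / (m.factorial : ℂ) =
        1 + (s * Y k : ℝ) * Complex.I - (((s * Y k) ^ 2 / 2 : ℝ) : ℂ) := by
      simp [Finset.sum_range_succ, mul_pow, Complex.I_sq]; ring
    rw [e2] at hb
    refine hb.trans ?_
    rw [← mul_pow]
    calc _ ≤ ‖((s * Y k : ℝ) * Complex.I : ℂ)‖ ^ 3 * 1 := by
          gcongr; norm_num [Nat.factorial]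
      _ ≤ _ := by rw [mul_one]; gcongr
  refine ⟨n, min (1 / B) (min (w / (8 * B ^ 3)) (1 / 4)), by positivity, w / 4, by positivity,
    fun m hm s hs => ?_⟩
  have hs1 : |s| ≤ 1 / B := hs.trans (min_le_left _ _)
  have hs2 : |s| ≤ w / (8 * B ^ 3) := hs.trans ((min_le_right _ _).trans (min_le_left _ _))
  have hs3 : |s| ≤ 1 / 4 := hs.trans ((min_le_right _ _).trans (min_le_right _ _))
  rw [le_div_iff₀ (by positivity)] at hs1 hs2
  have h1 := hloc s hs1
  have h2 := hμ.norm_centeredCharFun_sub_le hm s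
  have h3 := hμ.scaledVar_sub_le hm
  have h4 : scaledVar μ m - w ≤ w / 4 := by
    have := hμ.scaledVar_mono hn.2; rw [hw]; linarith [hn.1]
  have hss : s ^ 2 ≤ 1 / 16 := by rw [← sq_abs]; nlinarith [abs_nonneg s]
  have h5 : ‖((1 - s ^ 2 * w / 2 : ℝ) : ℂ)‖ = 1 - s ^ 2 * w / 2 := by
    rw [Complex.norm_real, Real.norm_eq_abs, abs_of_nonneg]
    nlinarith [sq_nonneg s]
  have h6 : |s| ^ 3 * B ^ 3 ≤ s ^ 2 * (w / 8) := by
    rw [← sq_abs s, pow_succ, mul_assoc]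
    have : |s| * B ^ 3 ≤ w / 8 := by linarith
    gcongr
  have h7 : s ^ 2 / 2 * (scaledVar μ m - w) ≤ s ^ 2 / 2 * (w / 4) := by gcongr
  have h8 := norm_le_norm_add_norm_sub' (centeredCharFun (μ n) (s / (n + 1)))
    ((1 - s ^ 2 * w / 2 : ℝ) : ℂ)
  have h9 := norm_le_norm_add_norm_sub (centeredCharFun (μ n) (s / (n + 1)))
    (centeredCharFun (μ m) (s / (m + 1)))
  rw [← hw] at h2
  linarith

lemma norm_centeredCharFun_three {μ : ℕ → Measure ℤ} (hμ : IsQuicksortLaw μ) {t : ℝ}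
    (ht : |t| ≤ Real.pi) :
    ‖centeredCharFun (μ 3) t‖ ≤ 1 - 4 / (9 * Real.pi ^ 2) * t ^ 2 := by
  have h2 (g : ℤ → ℂ) : ∫ k, g k ∂μ 2 = g 1 := by
    have h := hμ.integral_succ 1 g
    simp [Finset.Nat.antidiagonal_succ, hμ.2.1, hμ.2.2.1] at h
    norm_num at h
    have h' : (2 : ℂ) * ∫ k, g k ∂μ 2 = 2 * g 1 := by
      rw [two_mul (g 1), ← h]
    exact mul_left_cancel₀ two_ne_zero h'
  have h3 (g : ℤ → ℂ) : 3 * ∫ k, g k ∂μ 3 = g 2 + 2 * g 3 := by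
    have h := hμ.integral_succ 2 g
    simp [Finset.Nat.antidiagonal_succ, hμ.2.1, hμ.2.2.1, h2] at h
    norm_num at h
    linear_combination h
  have h4 := h3 (fun k => Complex.exp ((t * ((k : ℝ) - meanZ (μ 3)) : ℝ) * Complex.I))
  set m := meanZ (μ 3)
  have e3 : Complex.exp ((t * (((3 : ℤ) : ℝ) - m) : ℝ) * Complex.I) =
      Complex.exp ((t * (((2 : ℤ) : ℝ) - m) : ℝ) * Complex.I) * Complex.exp (t * Complex.I) := by
    rw [← Complex.exp_add]; congr 1; push_cast; ring
  rw [e3] at h4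
  have h5 : 3 * ‖centeredCharFun (μ 3) t‖ = ‖1 + 2 * Complex.exp (t * Complex.I)‖ := by
    have := congrArg norm h4
    rw [show ∀ a b : ℂ, a + 2 * (a * b) = a * (1 + 2 * b) by intros; ring, norm_mul, norm_mul,
      Complex.norm_exp_ofReal_mul_I, one_mul] at this
    rw [← this, Complex.norm_ofNat]
    rfl
  have h6 : ‖1 + 2 * Complex.exp (t * Complex.I)‖ ^ 2 = 5 + 4 * Real.cos t := by
    rw [Complex.sq_norm, Complex.normSq_apply]
    simp only [Complex.add_re, Complex.add_im, Complex.mul_re, Complex.mul_im,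
      Complex.exp_ofReal_mul_I_re, Complex.exp_ofReal_mul_I_im, Complex.one_re, Complex.one_im,
      Complex.re_ofNat, Complex.im_ofNat]
    nlinarith [Real.sin_sq_add_cos_sq t]
  have h7 := Real.cos_le_one_sub_mul_cos_sq ht
  have hpi := Real.pi_pos
  have h8 : 2 / Real.pi ^ 2 * t ^ 2 ≤ 2 := by
    rw [div_mul_eq_mul_div, div_le_iff₀ (by positivity)]
    have : t ^ 2 ≤ Real.pi ^ 2 := by rw [← sq_abs t]; gcongr
    linarith
  have e9 : 4 / (9 * Real.pi ^ 2) * t ^ 2 = 2 / 9 * (2 / Real.pi ^ 2 * t ^ 2) := by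
    field_simp; ring
  rw [e9]
  have h10 : (3 * ‖centeredCharFun (μ 3) t‖) ^ 2 ≤ 9 - 4 * (2 / Real.pi ^ 2 * t ^ 2) := by
    rw [h5, h6]; linarith
  refine abs_le_of_sq_le_sq' (?_ : _ ≤ (1 - 2 / 9 * (2 / Real.pi ^ 2 * t ^ 2)) ^ 2) ?_ |>.2
  · nlinarith [sq_nonneg (2 / Real.pi ^ 2 * t ^ 2)]
  · linarith

end IsQuicksortLaw

section QuadraticRecursion

open Finset.HasAntidiagonal (antidiagonal)

lemma sum_range_sum_antidiagonal_le_sq (c : ℕ → ℝ) (hc : ∀ i, 0 ≤ c i) (N : ℕ) :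
    ∑ k ∈ Finset.range N, ∑ p ∈ antidiagonal k, c p.1 * c p.2 ≤
      (∑ i ∈ Finset.range N, c i) ^ 2 := by
  rw [sq, Finset.sum_mul_sum, ← Finset.sum_product', Finset.sum_sigma']
  rw [← Finset.sum_image (s := (Finset.range N).sigma fun k => antidiagonal k)
    (g := fun x : (_ : ℕ) × ℕ × ℕ => x.2) (f := fun p : ℕ × ℕ => c p.1 * c p.2)]
  · refine Finset.sum_le_sum_of_subset_of_nonneg (fun p hp => ?_)
      fun p _ _ => mul_nonneg (hc _) (hc _)
    obtain ⟨⟨k, q⟩, hx, rfl⟩ := Finset.mem_image.1 hp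
    simp only [Finset.mem_sigma, Finset.mem_range, Finset.HasAntidiagonal.mem_antidiagonal] at hx
    simp only [Finset.mem_product, Finset.mem_range]
    omega
  · rintro ⟨k, q⟩ hx ⟨l, r⟩ hy h
    simp only [Finset.coe_sigma, Set.mem_sigma_iff, Finset.mem_coe, Finset.mem_range,
      Finset.HasAntidiagonal.mem_antidiagonal] at hx hy h
    obtain rfl := h
    rw [← hx.2, ← hy.2]



lemma sum_range_le_of_quadratic_recursion {a : ℕ → ℝ} (h0 : ∀ k, 0 ≤ a k) (h1 : ∀ k, a k ≤ 1)
    (hz : a 0 = 1)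
    (hrec : ∀ n : ℕ, ((n : ℝ) + 1) * a (n + 1) ≤ ∑ p ∈ antidiagonal n, a p.1 * a p.2)
    {M : ℕ} (hM : 1 ≤ M) {η : ℝ} (hη0 : 0 < η)
    (hη : η * M ≤ ∑ k ∈ Finset.range M, (1 - a k)) (N : ℕ) :
    ∑ k ∈ Finset.range N, a k ≤ 8 * M / η := by
  have hmono : ∑ k ∈ Finset.range N, a k ≤ ∑ k ∈ Finset.range (N + M + 1), a k :=
    Finset.sum_le_sum_of_subset_of_nonneg (by simp; omega) fun _ _ _ => h0 _
  refine hmono.trans ?_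
  set K := N + M with hK
  set A : ℝ → ℝ := fun z => ∑ k ∈ Finset.range (K + 1), a k * z ^ k with hA
  have hA1 : ∑ k ∈ Finset.range (K + 1), a k = A 1 := by simp [hA]
  have hApos : ∀ z : ℝ, 0 ≤ z → 1 ≤ A z := fun z hz0 => by
    simp only [hA, Finset.sum_range_succ']
    have : 0 ≤ ∑ k ∈ Finset.range K, a (k + 1) * z ^ (k + 1) :=
      Finset.sum_nonneg fun k _ => mul_nonneg (h0 _) (by positivity)
    simp [hz]; linarith
  have hd : ∀ z : ℝ, HasDerivAt A (∑ k ∈ Finset.range K, ((k : ℝ) + 1) * a (k + 1) * z ^ k) z := by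
    intro z
    have : HasDerivAt A (∑ k ∈ Finset.range (K + 1), a k * ((k : ℝ) * z ^ (k - 1))) z :=
      HasDerivAt.fun_sum fun k _ => (hasDerivAt_pow k z).const_mul (a k)
    convert! this using 1
    rw [Finset.sum_range_succ']
    simp only [Nat.cast_zero, zero_mul, mul_zero, add_zero, Nat.add_sub_cancel, Nat.cast_add,
      Nat.cast_one]
    exact Finset.sum_congr rfl fun k _ => by ring
  have hle : ∀ z : ℝ, 0 ≤ z →
      ∑ k ∈ Finset.range K, ((k : ℝ) + 1) * a (k + 1) * z ^ k ≤ A z ^ 2 := by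
    intro z hz0
    have e1 : ∑ k ∈ Finset.range K, ((k : ℝ) + 1) * a (k + 1) * z ^ k ≤
        ∑ k ∈ Finset.range K, ∑ p ∈ antidiagonal k, (a p.1 * z ^ p.1) * (a p.2 * z ^ p.2) := by
      refine Finset.sum_le_sum fun k _ => ?_
      refine (mul_le_mul_of_nonneg_right (hrec k) (by positivity)).trans_eq ?_
      rw [Finset.sum_mul]
      refine Finset.sum_congr rfl fun p hp => ?_
      rw [← Finset.HasAntidiagonal.mem_antidiagonal.1 hp, pow_add]; ring
    refine e1.trans ((sum_range_sum_antidiagonal_le_sq _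
      (fun i => mul_nonneg (h0 i) (by positivity)) K).trans ?_)
    have h3 : 0 ≤ ∑ i ∈ Finset.range K, a i * z ^ i :=
      Finset.sum_nonneg fun i _ => mul_nonneg (h0 i) (by positivity)
    have h4 : ∑ i ∈ Finset.range K, a i * z ^ i ≤ A z :=
      Finset.sum_le_sum_of_subset_of_nonneg (by simp) fun i _ _ =>
        mul_nonneg (h0 i) (by positivity)
    gcongr
  have hhd : ∀ z : ℝ, 0 ≤ z → HasDerivAt (fun z => z + (A z)⁻¹)
      (1 + -(∑ k ∈ Finset.range K, ((k : ℝ) + 1) * a (k + 1) * z ^ k) / A z ^ 2) z :=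
    fun z hz0 => (hasDerivAt_id z).add ((hd z).inv (by linarith [hApos z hz0]))
  have hmon : MonotoneOn (fun z => z + (A z)⁻¹) (Set.Ici 0) := by
    refine monotoneOn_of_deriv_nonneg (convex_Ici 0)
      (fun z hz0 => (hhd z hz0).continuousAt.continuousWithinAt)
      (fun z hz0 => ?_) fun z hz0 => ?_
    · exact (hhd z (interior_subset hz0)).differentiableAt.differentiableWithinAt
    · have hz0' : 0 ≤ z := interior_subset (s := Set.Ici (0 : ℝ)) hz0
      rw [(hhd z hz0').deriv, neg_div, ← sub_eq_add_neg, sub_nonneg]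
      have := hApos z hz0'
      rw [div_le_one (by positivity)]
      exact hle z hz0'
  have hM' : (1 : ℝ) ≤ M := by exact_mod_cast hM
  set z : ℝ := 1 - 1 / (2 * M) with hzdef
  have hzM : 1 - z = 1 / (2 * M) := by rw [hzdef]; ring
  have hz1 : z < 1 := by
    have : 0 < 1 / (2 * (M : ℝ)) := by positivity
    linarith
  have hz0 : 0 ≤ z := by
    have : 1 / (2 * (M : ℝ)) ≤ 1 := by rw [div_le_one (by positivity)]; linarith
    linarith
  have hhalf : ∀ k ∈ Finset.range M, (1 - a k) * (1 / 2) ≤ (1 - a k) * z ^ k := by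
    intro k hk
    have hkM : (k : ℝ) ≤ M := by exact_mod_cast (Finset.mem_range.1 hk).le
    refine mul_le_mul_of_nonneg_left ?_ (by linarith [h1 k])
    have := one_add_mul_le_pow (a := z - 1) (by linarith) k
    rw [add_sub_cancel] at this
    refine le_trans ?_ this
    have h5 : (k : ℝ) * (1 / (2 * M)) ≤ 1 / 2 := by
      rw [mul_one_div, div_le_div_iff₀ (by positivity) (by norm_num)]; linarith
    rw [← hzM] at h5
    linarith
  have hgeom : ∑ k ∈ Finset.range (K + 1), z ^ k ≤ 2 * M := by
    have h6 := mul_neg_geom_sum z (K + 1)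
    rw [hzM] at h6
    have h7 : 0 ≤ z ^ (K + 1) := by positivity
    have h8 : 1 / (2 * (M : ℝ)) * ∑ k ∈ Finset.range (K + 1), z ^ k ≤ 1 := by linarith
    rw [div_mul_eq_mul_div, one_mul, div_le_one (by positivity)] at h8
    exact h8
  have hAz : A z ≤ 2 * M - η * M / 2 := by
    have e1 : A z = ∑ k ∈ Finset.range (K + 1), z ^ k -
        ∑ k ∈ Finset.range (K + 1), (1 - a k) * z ^ k := by
      rw [← Finset.sum_sub_distrib]
      exact Finset.sum_congr rfl fun k _ => by ring
    have e2 : ∑ k ∈ Finset.range M, (1 - a k) * z ^ k ≤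
        ∑ k ∈ Finset.range (K + 1), (1 - a k) * z ^ k :=
      Finset.sum_le_sum_of_subset_of_nonneg (by simp; omega) fun k _ _ =>
        mul_nonneg (by linarith [h1 k]) (by positivity)
    have e3 := Finset.sum_le_sum hhalf
    rw [← Finset.sum_mul] at e3
    rw [e1]; linarith
  have hfin := hmon (Set.mem_Ici.2 hz0) (Set.mem_Ici.2 zero_le_one) hz1.le
  simp only at hfin
  have hAzpos := hApos z hz0
  have hA1pos := hApos 1 zero_le_one
  have h9 : (1 + η / 4) * (1 / (2 * M)) ≤ (A z)⁻¹ := by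
    rw [mul_one_div, ← one_div, div_le_div_iff₀ (by positivity) (by linarith)]
    nlinarith [mul_le_mul_of_nonneg_left hAz (by linarith : 0 ≤ 1 + η / 4),
      mul_nonneg (sq_nonneg η) (by linarith : (0 : ℝ) ≤ M)]
  have h10 : η / 4 * (1 / (2 * M)) ≤ (A 1)⁻¹ := by linarith
  rw [hA1, le_div_iff₀ hη0]
  rw [← one_div, le_div_iff₀ (by linarith)] at h10
  field_simp at h10
  linarith

lemma sq_mul_le_of_quadratic_recursion {a : ℕ → ℝ} (h0 : ∀ k, 0 ≤ a k) (h1 : ∀ k, a k ≤ 1)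
    (hz : a 0 = 1)
    (hrec : ∀ n : ℕ, ((n : ℝ) + 1) * a (n + 1) ≤ ∑ p ∈ antidiagonal n, a p.1 * a p.2)
    {B : ℝ} (hB : ∀ N, ∑ k ∈ Finset.range N, a k ≤ B) (n : ℕ) :
    ((n : ℝ) + 1) ^ 2 * a n ≤ 9 * B ^ 2 := by
  have hB1 : 1 ≤ B := by simpa [hz] using hB 1
  have hlin : ∀ k : ℕ, (k : ℝ) * a k ≤ B := by
    rintro (_ | k)
    · simp; linarith
    · refine le_trans ?_ (hB (k + 1))
      push_cast
      refine (hrec k).trans ?_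
      rw [← Finset.Nat.sum_antidiagonal_eq_sum_range_succ (fun i _ => a i) k]
      exact Finset.sum_le_sum fun p _ => mul_le_of_le_one_right (h0 _) (h1 _)
  have hquad : ∀ k : ℕ, (k : ℝ) * ((k + 1) * a (k + 1)) ≤ 2 * B ^ 2 := by
    intro k
    refine (mul_le_mul_of_nonneg_left (hrec k) k.cast_nonneg).trans ?_
    have e1 : (k : ℝ) * ∑ p ∈ antidiagonal k, a p.1 * a p.2 =
        ∑ p ∈ antidiagonal k, (p.1 * a p.1) * a p.2 +
          ∑ p ∈ antidiagonal k, (p.2 * a p.2) * a p.1 := by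
      rw [Finset.mul_sum, ← Finset.sum_add_distrib]
      refine Finset.sum_congr rfl fun p hp => ?_
      rw [← Finset.HasAntidiagonal.mem_antidiagonal.1 hp]; push_cast; ring
    have e2 : ∑ p ∈ antidiagonal k, (p.2 * a p.2) * a p.1 ≤ B * B := by
      refine (Finset.sum_le_sum fun p _ => mul_le_mul_of_nonneg_right (hlin p.2) (h0 _)).trans ?_
      rw [← Finset.mul_sum, Finset.Nat.sum_antidiagonal_eq_sum_range_succ (fun i _ => a i) k]
      exact mul_le_mul_of_nonneg_left (hB _) (by linarith)
    have e3 : ∑ p ∈ antidiagonal k, (p.1 * a p.1) * a p.2 ≤ B * B := by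
      rw [← Finset.Nat.sum_antidiagonal_swap]
      exact e2
    rw [e1]; linarith
  rcases n with _ | _ | n
  · simp [hz]; nlinarith
  · have := h1 1; norm_num; nlinarith
  · have := hquad (n + 1)
    have h3 := h0 (n + 1 + 1)
    push_cast at this ⊢
    have h4 : ((n : ℝ) + 1 + 1 + 1) ^ 2 * a (n + 1 + 1) ≤
        9 / 2 * (((n : ℝ) + 1) * ((n + 1 + 1) * a (n + 1 + 1))) := by
      have hn : (0 : ℝ) ≤ n := n.cast_nonneg
      have : ((n : ℝ) + 1 + 1 + 1) ^ 2 ≤ 9 / 2 * ((n + 1) * (n + 1 + 1)) := by nlinarith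
      calc _ ≤ 9 / 2 * (((n : ℝ) + 1) * (n + 1 + 1)) * a (n + 1 + 1) := by gcongr
        _ = _ := by ring
    linarith

end QuadraticRecursion

lemma norm_centeredCharFun (ν : Measure ℤ) (t : ℝ) :
    ‖centeredCharFun ν t‖ = ‖∫ k : ℤ, Complex.exp ((t * (k : ℝ) : ℝ) * Complex.I) ∂ν‖ := by
  have : centeredCharFun ν t = Complex.exp ((-(t * meanZ ν) : ℝ) * Complex.I) *
      ∫ k : ℤ, Complex.exp ((t * (k : ℝ) : ℝ) * Complex.I) ∂ν := by
    rw [centeredCharFun, ← integral_const_mul]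
    congr 1; ext k
    rw [← Complex.exp_add]; congr 1; push_cast; ring
  rw [this, norm_mul, Complex.norm_exp_ofReal_mul_I, one_mul]

namespace IsQuicksortLaw

open Finset.HasAntidiagonal (antidiagonal)

lemma norm_centeredCharFun_succ_le {μ : ℕ → Measure ℤ} (hμ : IsQuicksortLaw μ) (n : ℕ) (t : ℝ) :
    ((n : ℝ) + 1) * ‖centeredCharFun (μ (n + 1)) t‖ ≤
      ∑ p ∈ antidiagonal n, ‖centeredCharFun (μ p.1) t‖ * ‖centeredCharFun (μ p.2) t‖ := by
  simp only [norm_centeredCharFun]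
  have h := hμ.integral_succ n fun k : ℤ => Complex.exp ((t * (k : ℝ) : ℝ) * Complex.I)
  have e1 : ((n : ℝ) + 1) * ‖∫ k : ℤ, Complex.exp ((t * (k : ℝ) : ℝ) * Complex.I) ∂μ (n + 1)‖ =
      ‖((n : ℝ) + 1) • ∫ k : ℤ, Complex.exp ((t * (k : ℝ) : ℝ) * Complex.I) ∂μ (n + 1)‖ := by
    rw [norm_smul, Real.norm_of_nonneg (by positivity)]
  rw [e1, h]
  refine (norm_sum_le _ _).trans (Finset.sum_le_sum fun p _ => le_of_eq ?_)
  rw [← norm_mul, ← one_mul ‖_ * _‖, ← Complex.norm_exp_ofReal_mul_I (t * n), ← norm_mul]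
  congr 1
  rw [← integral_mul_const, ← integral_const_mul]
  congr 1; ext a
  rw [← integral_const_mul, ← integral_const_mul]
  congr 1; ext b
  rw [← Complex.exp_add, ← Complex.exp_add]
  congr 1; push_cast; ring

lemma centeredCharFun_zero {μ : ℕ → Measure ℤ} (hμ : IsQuicksortLaw μ) (t : ℝ) :
    centeredCharFun (μ 0) t = 1 := by
  rw [centeredCharFun, hμ.2.1, meanZ]
  simp

lemma sq_mul_norm_centeredCharFun_le {μ : ℕ → Measure ℤ} (hμ : IsQuicksortLaw μ) {t : ℝ} {M : ℕ}
    (hM : 1 ≤ M) {η : ℝ} (hη : 0 < η)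
    (h : η * M ≤ ∑ k ∈ Finset.range M, (1 - ‖centeredCharFun (μ k) t‖)) (n : ℕ) :
    ((n : ℝ) + 1) ^ 2 * ‖centeredCharFun (μ n) t‖ ≤ 9 * (8 * M / η) ^ 2 := by
  have h1 : ‖centeredCharFun (μ 0) t‖ = 1 := by simp [hμ.centeredCharFun_zero]
  exact sq_mul_le_of_quadratic_recursion (a := fun k => ‖centeredCharFun (μ k) t‖)
    (fun _ => norm_nonneg _) (fun k => hμ.norm_centeredCharFun_le_one k t) h1
    (fun k => hμ.norm_centeredCharFun_succ_le k t)
    (sum_range_le_of_quadratic_recursion (fun _ => norm_nonneg _)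
      (fun k => hμ.norm_centeredCharFun_le_one k t) h1
      (fun k => hμ.norm_centeredCharFun_succ_le k t) hM hη h) n

/-- Quadratic decay of the characteristic functions, uniformly in `n`. -/
lemma exists_norm_centeredCharFun_le_div {μ : ℕ → Measure ℤ} (hμ : IsQuicksortLaw μ) :
    ∃ C > 0, ∀ (n : ℕ) (t : ℝ), t ≠ 0 → |t| ≤ Real.pi →
      ‖centeredCharFun (μ n) t‖ ≤ C / (((n : ℝ) + 1) * t) ^ 2 := by
  obtain ⟨n₀, s₀, hs₀, c, hc, hloc⟩ := hμ.exists_norm_centeredCharFun_le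
  set t₀ : ℝ := s₀ / (2 * n₀ + 2) with ht₀
  have ht₀pos : 0 < t₀ := by positivity
  have hpi := Real.pi_pos
  set η₁ : ℝ := c * s₀ ^ 2 / 32 with hη₁
  set η₂ : ℝ := t₀ ^ 2 / (9 * Real.pi ^ 2) with hη₂
  have hη₁pos : 0 < η₁ := by positivity
  have hη₂pos : 0 < η₂ := by positivity
  refine ⟨9 * (8 * s₀ / η₁) ^ 2 + 9 * (32 / η₂) ^ 2 * Real.pi ^ 2, by positivity,
    fun n t htne htpi => ?_⟩
  have htpos : 0 < |t| := abs_pos.2 htne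
  rw [le_div_iff₀ (by positivity), mul_pow, mul_left_comm, mul_comm (‖_‖), ← mul_assoc]
  rcases le_or_gt |t| t₀ with hsmall | hlarge
  · set M : ℕ := ⌊s₀ / |t|⌋₊ with hMdef
    have hdiv : (2 * n₀ + 2 : ℝ) ≤ s₀ / |t| := by
      rw [ht₀, le_div_iff₀ (by positivity)] at hsmall
      rw [le_div_iff₀ htpos]; linarith
    have hM2 : 2 * n₀ + 2 ≤ M := by
      rw [hMdef, Nat.le_floor_iff (by positivity)]; exact_mod_cast hdiv
    have hMle : (M : ℝ) * |t| ≤ s₀ := by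
      rw [← le_div_iff₀ htpos]; exact Nat.floor_le (by positivity)
    have hMge : s₀ / 2 ≤ M * |t| := by
      have h1 : s₀ / |t| < M + 1 := Nat.lt_floor_add_one _
      rw [div_lt_iff₀ htpos] at h1
      have h2 : (2 : ℝ) ≤ M := by exact_mod_cast (by omega : 2 ≤ M)
      nlinarith
    have hterm : ∀ k ∈ Finset.Ico (M / 2) M, c * s₀ ^ 2 / 16 ≤ 1 - ‖centeredCharFun (μ k) t‖ := by
      intro k hk
      rw [Finset.mem_Ico] at hk
      have hk1 : (k : ℝ) + 1 ≤ M := by exact_mod_cast hk.2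
      have hk2 : (M : ℝ) ≤ 2 * (k + 1) := by exact_mod_cast (by omega : M ≤ 2 * (k + 1))
      have habs : |t * ((k : ℝ) + 1)| = |t| * (k + 1) := by
        rw [abs_mul, abs_of_nonneg (by positivity : (0 : ℝ) ≤ k + 1)]
      have h3 := hloc k (by omega) (t * (k + 1)) (by rw [habs]; nlinarith)
      rw [mul_div_cancel_right₀ _ (by positivity : (k : ℝ) + 1 ≠ 0)] at h3
      have h4 : s₀ / 4 ≤ |t * ((k : ℝ) + 1)| := by rw [habs]; nlinarith
      have h5 : (s₀ / 4) ^ 2 ≤ (t * ((k : ℝ) + 1)) ^ 2 := by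
        rw [← sq_abs (t * _)]; gcongr
      nlinarith
    have hsum : η₁ * M ≤ ∑ k ∈ Finset.range M, (1 - ‖centeredCharFun (μ k) t‖) := by
      have h1 := Finset.card_nsmul_le_sum _ _ _ hterm
      have h2 : ∑ k ∈ Finset.Ico (M / 2) M, (1 - ‖centeredCharFun (μ k) t‖) ≤
          ∑ k ∈ Finset.range M, (1 - ‖centeredCharFun (μ k) t‖) := by
        refine Finset.sum_le_sum_of_subset_of_nonneg (fun k hk => ?_) fun k _ _ =>
          sub_nonneg.2 (hμ.norm_centeredCharFun_le_one k t)
        rw [Finset.mem_Ico] at hk; exact Finset.mem_range.2 hk.2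
      rw [Nat.card_Ico, nsmul_eq_mul] at h1
      have h3 : (M : ℝ) / 2 ≤ ((M - M / 2 : ℕ) : ℝ) := by
        rw [div_le_iff₀ (by norm_num)]
        exact_mod_cast (by omega : M ≤ (M - M / 2) * 2)
      have h4 : (M : ℝ) / 2 * (c * s₀ ^ 2 / 16) ≤ ((M - M / 2 : ℕ) : ℝ) * (c * s₀ ^ 2 / 16) := by
        gcongr
      rw [hη₁]; linarith
    have h1 := hμ.sq_mul_norm_centeredCharFun_le (by omega) hη₁pos hsum n
    have h2 : (8 * M / η₁ * |t|) ^ 2 ≤ (8 * s₀ / η₁) ^ 2 := by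
      have : 8 * M / η₁ * |t| ≤ 8 * s₀ / η₁ := by
        rw [div_mul_eq_mul_div, mul_assoc]; gcongr
      gcongr
    rw [mul_pow, sq_abs] at h2
    have h3 : ((n : ℝ) + 1) ^ 2 * ‖centeredCharFun (μ n) t‖ * t ^ 2 ≤
        9 * (8 * M / η₁) ^ 2 * t ^ 2 := by gcongr
    have h4 : 0 ≤ 9 * (32 / η₂) ^ 2 * Real.pi ^ 2 := by positivity
    linarith
  · have hsum : η₂ * (4 : ℕ) ≤ ∑ k ∈ Finset.range 4, (1 - ‖centeredCharFun (μ k) t‖) := by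
      have h1 := hμ.norm_centeredCharFun_three htpi
      have h2 : t₀ ^ 2 ≤ t ^ 2 := by rw [← sq_abs t]; gcongr
      have h3 := Finset.single_le_sum (f := fun k => 1 - ‖centeredCharFun (μ k) t‖)
        (fun k _ => sub_nonneg.2 (hμ.norm_centeredCharFun_le_one k t))
        (Finset.mem_range.2 (by norm_num : 3 < 4))
      have h4 : η₂ * (4 : ℕ) ≤ 4 / (9 * Real.pi ^ 2) * t ^ 2 := by
        rw [hη₂, div_mul_eq_mul_div, div_mul_eq_mul_div]
        push_cast
        gcongr ?_ / _
        linarith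
      refine h4.trans (le_trans ?_ h3)
      linarith
    have h1 := hμ.sq_mul_norm_centeredCharFun_le (by norm_num) hη₂pos hsum n
    push_cast at h1
    norm_num only at h1
    have h2 : t ^ 2 ≤ Real.pi ^ 2 := by rw [← sq_abs t]; gcongr
    have h3 : ((n : ℝ) + 1) ^ 2 * ‖centeredCharFun (μ n) t‖ * t ^ 2 ≤
        9 * (32 / η₂) ^ 2 * Real.pi ^ 2 := by gcongr
    have h4 : 0 ≤ 9 * (8 * s₀ / η₁) ^ 2 := by positivity
    linarith

end IsQuicksortLaw

/-- The limit of the characteristic functions of `(Q_n - q_n) / (n + 1)`. -/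
noncomputable def limitCharFun (μ : ℕ → Measure ℤ) (s : ℝ) : ℂ :=
  limUnder atTop fun n : ℕ => centeredCharFun (μ n) (s / (n + 1))

lemma centeredCharFun_neg (ν : Measure ℤ) (t : ℝ) :
    centeredCharFun ν (-t) = starRingEnd ℂ (centeredCharFun ν t) := by
  rw [centeredCharFun, centeredCharFun, ← integral_conj]
  congr 1; ext k
  rw [← Complex.exp_conj]
  simp

namespace IsQuicksortLaw

lemma norm_centeredCharFun_sub_le_div_sqrt {μ : ℕ → Measure ℤ} (hμ : IsQuicksortLaw μ) {n m : ℕ}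
    (hnm : n ≤ m) (s : ℝ) :
    ‖centeredCharFun (μ n) (s / (n + 1)) - centeredCharFun (μ m) (s / (m + 1))‖ ≤
      20 * s ^ 2 / √((n : ℝ) + 1) := by
  refine (hμ.norm_centeredCharFun_sub_le hnm s).trans ?_
  calc s ^ 2 / 2 * (scaledVar μ m - scaledVar μ n) ≤ s ^ 2 / 2 * (40 / √((n : ℝ) + 1)) := by
        gcongr; exact hμ.scaledVar_sub_le hnm
    _ = _ := by ring

lemma tendsto_limitCharFun {μ : ℕ → Measure ℤ} (hμ : IsQuicksortLaw μ) (s : ℝ) :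
    Tendsto (fun n : ℕ => centeredCharFun (μ n) (s / (n + 1))) atTop
      (nhds (limitCharFun μ s)) := by
  refine CauchySeq.tendsto_limUnder (cauchySeq_of_le_tendsto_0'
    (fun n : ℕ => 20 * s ^ 2 / √((n : ℝ) + 1)) (fun n m hnm => ?_) ?_)
  · rw [dist_eq_norm]; exact hμ.norm_centeredCharFun_sub_le_div_sqrt hnm s
  · exact tendsto_const_nhds.div_atTop (Real.tendsto_sqrt_atTop.comp
      (tendsto_atTop_add_const_right _ _ tendsto_natCast_atTop_atTop))

lemma norm_sub_limitCharFun_le {μ : ℕ → Measure ℤ} (hμ : IsQuicksortLaw μ) (n : ℕ) (s : ℝ) :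
    ‖centeredCharFun (μ n) (s / (n + 1)) - limitCharFun μ s‖ ≤ 20 * s ^ 2 / √((n : ℝ) + 1) :=
  le_of_tendsto (tendsto_const_nhds.sub (hμ.tendsto_limitCharFun s)).norm
    ((eventually_ge_atTop n).mono fun _ hm => hμ.norm_centeredCharFun_sub_le_div_sqrt hm s)

lemma lipschitz_limitCharFun {μ : ℕ → Measure ℤ} (hμ : IsQuicksortLaw μ) (s t : ℝ) :
    ‖limitCharFun μ s - limitCharFun μ t‖ ≤ 7 * |s - t| :=
  le_of_tendsto ((hμ.tendsto_limitCharFun s).sub (hμ.tendsto_limitCharFun t)).norm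
    (.of_forall fun n => hμ.lipschitz_centeredCharFun n s t)

lemma continuous_limitCharFun {μ : ℕ → Measure ℤ} (hμ : IsQuicksortLaw μ) :
    Continuous (limitCharFun μ) :=
  (LipschitzWith.of_dist_le_mul (K := 7) fun s t => by
    rw [dist_eq_norm, Real.dist_eq]; exact hμ.lipschitz_limitCharFun s t).continuous

lemma limitCharFun_neg {μ : ℕ → Measure ℤ} (hμ : IsQuicksortLaw μ) (s : ℝ) :
    limitCharFun μ (-s) = starRingEnd ℂ (limitCharFun μ s) := by
  refine tendsto_nhds_unique (hμ.tendsto_limitCharFun (-s)) ?_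
  simp only [neg_div, centeredCharFun_neg]
  exact (Complex.continuous_conj.tendsto _).comp (hμ.tendsto_limitCharFun s)

lemma limitCharFun_zero {μ : ℕ → Measure ℤ} (hμ : IsQuicksortLaw μ) : limitCharFun μ 0 = 1 := by
  refine tendsto_nhds_unique (hμ.tendsto_limitCharFun 0) ?_
  have (n : ℕ) : centeredCharFun (μ n) (0 / (n + 1)) = 1 := by
    have := hμ.1 n
    simp [centeredCharFun]
  simp only [this]
  exact tendsto_const_nhds

/-- Decay of the characteristic functions and of their limit. -/
lemma exists_charFun_decay {μ : ℕ → Measure ℤ} (hμ : IsQuicksortLaw μ) :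
    ∃ D > 0, (∀ (n : ℕ) (t : ℝ), |t| ≤ Real.pi →
        ‖centeredCharFun (μ n) t‖ ≤ D * (1 + ((n + 1) * t) ^ 2)⁻¹) ∧
      ∀ s : ℝ, ‖limitCharFun μ s‖ ≤ D * (1 + s ^ 2)⁻¹ := by
  obtain ⟨C, hC, h⟩ := hμ.exists_norm_centeredCharFun_le_div
  have key : ∀ (n : ℕ) (t : ℝ), |t| ≤ Real.pi →
      ‖centeredCharFun (μ n) t‖ ≤ (1 + C) * (1 + ((n + 1) * t) ^ 2)⁻¹ := by
    intro n t ht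
    rw [← div_eq_mul_inv, le_div_iff₀ (by positivity)]
    have h1 := hμ.norm_centeredCharFun_le_one n t
    rcases eq_or_ne t 0 with rfl | ht0
    · simp; linarith
    · have h2 := h n t ht0 ht
      rw [le_div_iff₀ (by positivity)] at h2
      linarith
  refine ⟨1 + C, by positivity, key, fun s => ?_⟩
  refine le_of_tendsto (hμ.tendsto_limitCharFun s).norm ?_
  have hlim : Tendsto (fun n : ℕ => s / ((n : ℝ) + 1)) atTop (nhds 0) :=
    tendsto_const_nhds.div_atTop (tendsto_atTop_add_const_right _ _ tendsto_natCast_atTop_atTop)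
  have hev : ∀ᶠ n : ℕ in atTop, |s / ((n : ℝ) + 1)| < Real.pi := by
    have := hlim.abs
    rw [abs_zero] at this
    exact this.eventually (gt_mem_nhds Real.pi_pos)
  filter_upwards [hev] with n hn
  have := key n _ hn.le
  rwa [mul_div_cancel₀ _ (by positivity : (n : ℝ) + 1 ≠ 0)] at this

lemma integrable_limitCharFun {μ : ℕ → Measure ℤ} (hμ : IsQuicksortLaw μ) :
    Integrable (limitCharFun μ) := by
  obtain ⟨D, -, -, h⟩ := hμ.exists_charFun_decay
  exact (integrable_inv_one_add_sq.const_mul D).mono'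
    hμ.continuous_limitCharFun.aestronglyMeasurable
    (.of_forall h)

end IsQuicksortLaw

lemma le_mul_rpow_of_le_of_le {x K u r : ℝ} (hx : 0 ≤ x) (hK : 0 < K) (hu : 0 < u) (hr : 0 ≤ r)
    (h1 : x ≤ K * (u * r)) (h2 : x ≤ K * u⁻¹) :
    x ≤ K * r ^ (1 / 8 : ℝ) * u ^ (-(3 / 2) / 2 : ℝ) := by
  have e1 : x = x ^ (1 / 8 : ℝ) * x ^ (7 / 8 : ℝ) := by
    rw [← Real.rpow_add_of_nonneg hx (by norm_num) (by norm_num)]; norm_num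
  have e2 : K = K ^ (1 / 8 : ℝ) * K ^ (7 / 8 : ℝ) := by
    rw [← Real.rpow_add hK]; norm_num
  have e3 : u ^ (-(3 / 2) / 2 : ℝ) = u ^ (1 / 8 : ℝ) * u⁻¹ ^ (7 / 8 : ℝ) := by
    rw [Real.inv_rpow hu.le, ← Real.rpow_neg hu.le, ← Real.rpow_add hu]; norm_num
  calc x = x ^ (1 / 8 : ℝ) * x ^ (7 / 8 : ℝ) := e1
    _ ≤ (K * (u * r)) ^ (1 / 8 : ℝ) * (K * u⁻¹) ^ (7 / 8 : ℝ) := by gcongr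
    _ = (K ^ (1 / 8 : ℝ) * K ^ (7 / 8 : ℝ)) * r ^ (1 / 8 : ℝ) *
          (u ^ (1 / 8 : ℝ) * u⁻¹ ^ (7 / 8 : ℝ)) := by
        rw [Real.mul_rpow hK.le (by positivity), Real.mul_rpow hu.le hr,
          Real.mul_rpow hK.le (by positivity)]; ring
    _ = _ := by rw [← e2, ← e3]

namespace IsQuicksortLaw

/-- Quantitative comparison of the characteristic function of `Q_n` with its limit. -/
lemma exists_norm_sub_limitCharFun_le {μ : ℕ → Measure ℤ} (hμ : IsQuicksortLaw μ) :
    ∃ K > 0, ∀ n : ℕ, 1 ≤ n → ∀ t : ℝ,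
      ‖(Set.Ioc (-Real.pi) Real.pi).indicator (centeredCharFun (μ n)) t -
          limitCharFun μ (n * t)‖ ≤
        K * (n : ℝ) ^ (-(1 / 16) : ℝ) * (1 + (n * t) ^ 2) ^ (-(3 / 2) / 2 : ℝ) := by
  obtain ⟨D, hD, hdec, hlim⟩ := hμ.exists_charFun_decay
  refine ⟨2 * D + 87, by positivity, fun n hn t => ?_⟩
  have hn1 : (1 : ℝ) ≤ n := by exact_mod_cast hn
  have hsqrt : 1 ≤ √(n : ℝ) := Real.one_le_sqrt.2 hn1
  have hsq := Real.sq_sqrt (by positivity : (0 : ℝ) ≤ n)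
  have hr : (n : ℝ) ^ (-(1 / 16) : ℝ) = ((√(n : ℝ))⁻¹) ^ (1 / 8 : ℝ) := by
    rw [Real.sqrt_eq_rpow, ← Real.rpow_neg (by positivity), ← Real.rpow_mul (by positivity)]
    norm_num
  rw [hr]
  have hpi := Real.two_le_pi
  set s : ℝ := n * t with hs
  have hl := hlim s
  by_cases ht : t ∈ Set.Ioc (-Real.pi) Real.pi
  · rw [Set.indicator_of_mem ht]
    have ht' : |t| ≤ Real.pi := abs_le.2 ⟨ht.1.le, ht.2⟩
    refine le_mul_rpow_of_le_of_le (norm_nonneg _) (by positivity) (by positivity) (by positivity)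
      ?_ ?_
    · have h1 := hμ.norm_sub_limitCharFun_le n ((n + 1) * t)
      rw [mul_div_cancel_left₀ _ (by positivity : (n : ℝ) + 1 ≠ 0)] at h1
      have h2 := hμ.lipschitz_limitCharFun ((n + 1) * t) s
      rw [hs, show ((n : ℝ) + 1) * t - n * t = t by ring, ← hs] at h2
      have h3 := norm_sub_le_norm_sub_add_norm_sub (centeredCharFun (μ n) t)
        (limitCharFun μ ((n + 1) * t)) (limitCharFun μ s)
      have h4 : 20 * (((n : ℝ) + 1) * t) ^ 2 / √((n : ℝ) + 1) ≤ 80 * s ^ 2 / √(n : ℝ) := by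
        have : ((n : ℝ) + 1) ^ 2 ≤ 4 * n ^ 2 := by nlinarith
        have h5 : 20 * (((n : ℝ) + 1) * t) ^ 2 ≤ 80 * s ^ 2 := by
          rw [hs, mul_pow, mul_pow]; nlinarith [sq_nonneg t]
        gcongr; linarith
      have h6 : 7 * |t| ≤ 7 * (1 + s ^ 2) / √(n : ℝ) := by
        rw [le_div_iff₀ (by positivity)]
        have h7 : |t| * √(n : ℝ) ≤ |s| := by
          rw [hs, abs_mul, abs_of_nonneg (by positivity : (0 : ℝ) ≤ n), mul_comm]
          gcongr; nlinarith
        nlinarith [sq_nonneg (|s| - 1), sq_abs s]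
      have h8 : 80 * s ^ 2 / √(n : ℝ) + 7 * (1 + s ^ 2) / √(n : ℝ) ≤
          (2 * D + 87) * ((1 + s ^ 2) * (√(n : ℝ))⁻¹) := by
        rw [← add_div, ← mul_assoc, ← div_eq_mul_inv]
        gcongr; nlinarith [sq_nonneg s]
      linarith
    · have h1 := hdec n t ht'
      have h2 : (1 + (((n : ℝ) + 1) * t) ^ 2)⁻¹ ≤ (1 + s ^ 2)⁻¹ := by
        rw [hs, mul_pow, mul_pow]; gcongr; linarith
      have h3 : 0 ≤ (1 + s ^ 2)⁻¹ := by positivity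
      refine (norm_sub_le _ _).trans ?_
      nlinarith
  · rw [Set.indicator_of_notMem ht, zero_sub, norm_neg]
    have ht' : 1 ≤ t ^ 2 := by
      have : 2 ≤ |t| := by
        by_contra! hc
        rw [abs_lt] at hc
        exact ht ⟨by linarith, by linarith⟩
      rw [← sq_abs]; nlinarith
    have h3 : 0 ≤ (1 + s ^ 2)⁻¹ := by positivity
    refine le_mul_rpow_of_le_of_le (norm_nonneg _) (by positivity) (by positivity) (by positivity)
      ?_ (by nlinarith)
    have h4 : (1 + s ^ 2)⁻¹ ≤ 1 := inv_le_one_of_one_le₀ (by linarith [sq_nonneg s])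
    have h5 : 1 ≤ (1 + s ^ 2) * (√(n : ℝ))⁻¹ := by
      rw [← div_eq_mul_inv, le_div_iff₀ (by positivity), hs, mul_pow]
      nlinarith
    nlinarith

end IsQuicksortLaw

lemma integral_Ioc_exp_int (m : ℤ) :
    ∫ t in Set.Ioc (-Real.pi) Real.pi, Complex.exp ((t * m : ℝ) * Complex.I) =
      if m = 0 then (2 * Real.pi : ℂ) else 0 := by
  rw [← intervalIntegral.integral_of_le (by linarith [Real.pi_pos])]
  split_ifs with h
  · subst h
    simp; ring
  · have hc : (m * Complex.I : ℂ) ≠ 0 := mul_ne_zero (by exact_mod_cast h) Complex.I_ne_zero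
    have := integral_exp_mul_complex (a := -Real.pi) (b := Real.pi) hc
    have e1 : ∀ t : ℝ, ((t * m : ℝ) * Complex.I : ℂ) = m * Complex.I * t := fun t => by
      push_cast; ring
    simp only [e1, this]
    rw [div_eq_zero_iff]; left
    rw [sub_eq_zero, Complex.exp_eq_exp_iff_exists_int]
    exact ⟨m, by push_cast; ring⟩

/-- Fourier inversion for laws on `ℤ`. -/
lemma integral_Ioc_exp_mul_centeredCharFun (ν : Measure ℤ) [IsProbabilityMeasure ν] (x : ℤ) :
    ∫ t in Set.Ioc (-Real.pi) Real.pi,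
        Complex.exp ((-(t * ((x : ℝ) - meanZ ν)) : ℝ) * Complex.I) * centeredCharFun ν t =
      2 * Real.pi * (ν {x}).toReal := by
  have e1 : ∀ t : ℝ, Complex.exp ((-(t * ((x : ℝ) - meanZ ν)) : ℝ) * Complex.I) *
      centeredCharFun ν t = ∫ k, Complex.exp ((t * ((k - x : ℤ) : ℝ) : ℝ) * Complex.I) ∂ν := by
    intro t
    rw [centeredCharFun, ← integral_const_mul]
    congr 1; ext k
    rw [← Complex.exp_add]; congr 1; push_cast; ring
  simp only [e1]
  rw [integral_integral_swap]
  · simp only [integral_Ioc_exp_int, sub_eq_zero]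
    have e2 : (fun k : ℤ => if k = x then (2 * Real.pi : ℂ) else 0) =
        Set.indicator {x} fun _ => (2 * Real.pi : ℂ) := by
      ext k; simp [Set.indicator_apply]
    rw [e2, integral_indicator (measurableSet_singleton x), setIntegral_const,
      Complex.real_smul, Measure.real, mul_comm]
  · refine Integrable.of_bound (C := 1) ?_ (.of_forall fun p => ?_)
    · refine Measurable.aestronglyMeasurable ?_
      refine Complex.measurable_exp.comp (Measurable.mul_const ?_ _)
      refine Complex.measurable_ofReal.comp (measurable_fst.mul ?_)
      exact (measurable_from_top (f := fun k : ℤ => ((k - x : ℤ) : ℝ))).comp measurable_snd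
    · exact (Complex.norm_exp_ofReal_mul_I _).le

/-- The density obtained from `limitCharFun` by Fourier inversion. -/
noncomputable def limitDensity (μ : ℕ → Measure ℤ) (y : ℝ) : ℝ :=
  (∫ s : ℝ, Complex.exp ((-(s * y) : ℝ) * Complex.I) * limitCharFun μ s).re / (2 * Real.pi)

namespace IsQuicksortLaw

lemma ofReal_limitDensity {μ : ℕ → Measure ℤ} (hμ : IsQuicksortLaw μ) (y : ℝ) :
    2 * Real.pi * (limitDensity μ y : ℂ) =
      ∫ s : ℝ, Complex.exp ((-(s * y) : ℝ) * Complex.I) * limitCharFun μ s := by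
  set z := ∫ s : ℝ, Complex.exp ((-(s * y) : ℝ) * Complex.I) * limitCharFun μ s with hz
  have hconj : starRingEnd ℂ z = z := by
    rw [hz, ← integral_conj, ← integral_neg_eq_self]
    congr 1; ext s
    rw [map_mul, ← hμ.limitCharFun_neg, neg_neg, ← Complex.exp_conj]
    congr 2
    simp
  rw [Complex.conj_eq_iff_re] at hconj
  rw [limitDensity, ← hz]
  conv_rhs => rw [← hconj]
  push_cast
  have := Real.pi_pos.ne'
  field_simp

lemma continuous_limitDensity {μ : ℕ → Measure ℤ} (hμ : IsQuicksortLaw μ) :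
    Continuous (limitDensity μ) := by
  refine (Complex.continuous_re.comp ?_).div_const _
  refine continuous_of_dominated (bound := fun s => ‖limitCharFun μ s‖) (fun y => ?_)
    (fun y => .of_forall fun s => ?_) hμ.integrable_limitCharFun.norm (.of_forall fun s => ?_)
  · have := hμ.continuous_limitCharFun
    exact Continuous.aestronglyMeasurable (by fun_prop)
  · rw [norm_mul, Complex.norm_exp_ofReal_mul_I, one_mul]
  · fun_prop

/-- The local limit theorem with a rate. -/
lemma exists_abs_measure_singleton_sub_le {μ : ℕ → Measure ℤ} (hμ : IsQuicksortLaw μ) :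
    ∃ C : ℝ, ∀ n : ℕ, 1 ≤ n → ∀ x : ℤ,
      |((μ n) {x}).toReal - (n : ℝ)⁻¹ * limitDensity μ (((x : ℝ) - meanZ (μ n)) / n)| ≤
        C * (n : ℝ) ^ (-1 - 1 / 16 : ℝ) := by
  obtain ⟨K, hK, h⟩ := hμ.exists_norm_sub_limitCharFun_le
  set J : ℝ := ∫ s : ℝ, (1 + s ^ 2) ^ (-(3 / 2) / 2 : ℝ) with hJ
  have h_int : Integrable fun s : ℝ => (1 + s ^ 2) ^ (-(3 / 2) / 2 : ℝ) := by
    have := integrable_rpow_neg_one_add_norm_sq (E := ℝ) (μ := volume) (r := 3 / 2)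
      (by simp; norm_num)
    simpa using this
  refine ⟨K * J / (2 * Real.pi), fun n hn x => ?_⟩
  have := hμ.1 n
  have hpi := Real.pi_pos
  have hn0 : (0 : ℝ) < n := by exact_mod_cast hn
  set Y : ℝ := (x : ℝ) - meanZ (μ n) with hY
  set e : ℝ → ℂ := fun t => Complex.exp ((-(t * Y) : ℝ) * Complex.I) with he
  have h1 : (2 * Real.pi * ((μ n) {x}).toReal : ℂ) =
      ∫ t, e t * (Set.Ioc (-Real.pi) Real.pi).indicator (centeredCharFun (μ n)) t := by
    rw [← integral_Ioc_exp_mul_centeredCharFun, ← integral_indicator measurableSet_Ioc]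
    congr 1; ext t
    by_cases ht : t ∈ Set.Ioc (-Real.pi) Real.pi <;> simp [ht, he, hY]
  have h2 : (2 * Real.pi * ((n : ℝ)⁻¹ * limitDensity μ (Y / n) : ℝ) : ℂ) =
      ∫ t, e t * limitCharFun μ (n * t) := by
    have h3 := Measure.integral_comp_mul_left (fun s : ℝ =>
      Complex.exp ((-(s * (Y / n)) : ℝ) * Complex.I) * limitCharFun μ s) (n : ℝ)
    rw [← hμ.ofReal_limitDensity, abs_of_pos (inv_pos.2 hn0)] at h3
    have e3 : ∀ t : ℝ, (n : ℝ) * t * (Y / n) = t * Y := fun t => by field_simp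
    simp only [e3] at h3
    rw [h3, Complex.real_smul]
    push_cast; ring
  have hcont : Continuous (centeredCharFun (μ n)) := by
    have h4 : LipschitzWith (7 * (n + 1)) (centeredCharFun (μ n)) := by
      refine LipschitzWith.of_dist_le_mul fun s t => ?_
      have h5 := hμ.lipschitz_centeredCharFun n (s * (n + 1)) (t * (n + 1))
      rw [mul_div_cancel_right₀ _ (by positivity), mul_div_cancel_right₀ _ (by positivity),
        ← sub_mul, abs_mul, abs_of_nonneg (by positivity : (0 : ℝ) ≤ n + 1)] at h5
      rw [dist_eq_norm, Real.dist_eq]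
      refine h5.trans_eq ?_
      push_cast; ring
    exact h4.continuous
  have hecont : Continuous e := by fun_prop
  have hi1 : Integrable fun t => e t *
      (Set.Ioc (-Real.pi) Real.pi).indicator (centeredCharFun (μ n)) t := by
    refine Integrable.bdd_mul (c := 1) ?_ hecont.aestronglyMeasurable
      (.of_forall fun t => (Complex.norm_exp_ofReal_mul_I _).le)
    rw [integrable_indicator_iff measurableSet_Ioc]
    exact (hcont.integrableOn_Icc).mono_set Set.Ioc_subset_Icc_self
  have hi2 : Integrable fun t => e t * limitCharFun μ (n * t) := by
    refine Integrable.bdd_mul (c := 1) ?_ hecont.aestronglyMeasurable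
      (.of_forall fun t => (Complex.norm_exp_ofReal_mul_I _).le)
    exact hμ.integrable_limitCharFun.comp_mul_left' hn0.ne'
  have h6 : (2 * Real.pi * (((μ n) {x}).toReal - (n : ℝ)⁻¹ * limitDensity μ (Y / n) : ℝ) : ℂ) =
      ∫ t, e t * ((Set.Ioc (-Real.pi) Real.pi).indicator (centeredCharFun (μ n)) t -
        limitCharFun μ (n * t)) := by
    simp only [mul_sub]
    rw [integral_sub hi1 hi2, ← h1, ← h2]
    push_cast; ring
  have h7 := congrArg norm h6
  rw [← Complex.ofReal_ofNat, ← Complex.ofReal_mul, ← Complex.ofReal_mul, Complex.norm_real,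
    Real.norm_eq_abs, abs_mul, abs_of_pos (by positivity : 0 < 2 * Real.pi)] at h7
  have h8 : ‖∫ t, e t * ((Set.Ioc (-Real.pi) Real.pi).indicator (centeredCharFun (μ n)) t -
        limitCharFun μ (n * t))‖ ≤
      ∫ t : ℝ, K * (n : ℝ) ^ (-(1 / 16) : ℝ) * (1 + (n * t) ^ 2) ^ (-(3 / 2) / 2 : ℝ) := by
    refine norm_integral_le_of_norm_le ((h_int.comp_mul_left' hn0.ne').const_mul _)
      (.of_forall fun t => ?_)
    rw [norm_mul, Complex.norm_exp_ofReal_mul_I, one_mul]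
    exact h n hn t
  rw [integral_const_mul, Measure.integral_comp_mul_left (fun s : ℝ =>
    (1 + s ^ 2) ^ (-(3 / 2) / 2 : ℝ)), ← hJ, abs_of_pos (inv_pos.2 hn0), smul_eq_mul] at h8
  have h9 : (n : ℝ) ^ (-1 - 1 / 16 : ℝ) = (n : ℝ)⁻¹ * (n : ℝ) ^ (-(1 / 16) : ℝ) := by
    rw [sub_eq_add_neg, Real.rpow_add hn0, Real.rpow_neg_one]
  rw [h9, div_mul_eq_mul_div, le_div_iff₀ (by positivity), mul_comm, h7]
  linarith

lemma tendsto_floor_sub_div (y c : ℝ) (q : ℕ → ℝ) :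
    Tendsto (fun n : ℕ => ((⌊n * y + c + q n⌋ : ℝ) - q n) / n) atTop (nhds y) := by
  have h : Tendsto (fun n : ℕ => (|c| + 1) / (n : ℝ)) atTop (nhds 0) :=
    tendsto_const_nhds.div_atTop tendsto_natCast_atTop_atTop
  rw [tendsto_iff_dist_tendsto_zero]
  refine squeeze_zero' (.of_forall fun _ => dist_nonneg) ?_ h
  filter_upwards [eventually_gt_atTop 0] with n hn
  have hn' : (0 : ℝ) < n := by exact_mod_cast hn
  rw [Real.dist_eq, div_sub' hn'.ne', abs_div, abs_of_pos hn']
  gcongr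
  have h1 := Int.floor_le (n * y + c + q n)
  have h2 := Int.lt_floor_add_one (n * y + c + q n)
  rw [abs_le]
  constructor <;> linarith [le_abs_self c, neg_abs_le c]

lemma tendsto_rpow_neg_one_div_sixteen (C : ℝ) :
    Tendsto (fun n : ℕ => C * (n : ℝ) ^ (-(1 / 16) : ℝ)) atTop (nhds 0) := by
  have := (tendsto_rpow_neg_atTop (by norm_num : (0 : ℝ) < 1 / 16)).comp
    (tendsto_natCast_atTop_atTop (R := ℝ))
  simpa using this.const_mul C

lemma exists_abs_mul_measure_singleton_sub_le {μ : ℕ → Measure ℤ} (hμ : IsQuicksortLaw μ) :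
    ∃ C : ℝ, ∀ n : ℕ, 1 ≤ n → ∀ x : ℤ,
      |n * ((μ n) {x}).toReal - limitDensity μ (((x : ℝ) - meanZ (μ n)) / n)| ≤
        C * (n : ℝ) ^ (-(1 / 16) : ℝ) := by
  obtain ⟨C, hC⟩ := hμ.exists_abs_measure_singleton_sub_le
  refine ⟨C, fun n hn x => ?_⟩
  have hn0 : (0 : ℝ) < n := by exact_mod_cast hn
  have h := mul_le_mul_of_nonneg_left (hC n hn x) hn0.le
  rw [sub_eq_add_neg (-1 : ℝ), Real.rpow_add hn0, Real.rpow_neg_one] at h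
  rw [← abs_of_pos hn0, ← abs_mul, abs_of_pos hn0, mul_sub, mul_inv_cancel_left₀ hn0.ne'] at h
  refine h.trans_eq ?_
  field_simp

lemma limitDensity_nonneg {μ : ℕ → Measure ℤ} (hμ : IsQuicksortLaw μ) (y : ℝ) :
    0 ≤ limitDensity μ y := by
  obtain ⟨C, hC⟩ := hμ.exists_abs_mul_measure_singleton_sub_le
  have h1 := (hμ.continuous_limitDensity.tendsto y).comp
    (tendsto_floor_sub_div y 0 fun n => meanZ (μ n))
  have h2 := h1.add (tendsto_rpow_neg_one_div_sixteen C)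
  rw [add_zero] at h2
  refine ge_of_tendsto h2 ?_
  filter_upwards [eventually_ge_atTop 1] with n hn
  have h3 := (abs_le.1 (hC n hn ⌊n * y + 0 + meanZ (μ n)⌋)).2
  have h4 : 0 ≤ (n : ℝ) * ((μ n) {⌊n * y + 0 + meanZ (μ n)⌋}).toReal := by positivity
  simp only [Function.comp]
  linarith

lemma norm_limitCharFun_le_one {μ : ℕ → Measure ℤ} (hμ : IsQuicksortLaw μ) (s : ℝ) :
    ‖limitCharFun μ s‖ ≤ 1 :=
  le_of_tendsto (hμ.tendsto_limitCharFun s).norm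
    (.of_forall fun n => hμ.norm_centeredCharFun_le_one n _)

open scoped NNReal

lemma integral_limitDensity_gaussianReal_le {μ : ℕ → Measure ℤ} (hμ : IsQuicksortLaw μ)
    {w : ℝ≥0} (hw : 0 < w) :
    2 * Real.pi * ∫ y, limitDensity μ y ∂gaussianReal 0 w ≤ √(2 * Real.pi / w) := by
  have h1 : ((2 * Real.pi * ∫ y, limitDensity μ y ∂gaussianReal 0 w : ℝ) : ℂ) =
      ∫ s, limitCharFun μ s * charFun (gaussianReal 0 w) (-s) := by
    push_cast
    rw [← integral_complex_ofReal, ← integral_const_mul]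
    simp only [hμ.ofReal_limitDensity]
    rw [integral_integral_swap]
    · congr 1; ext s
      rw [charFun_apply_real, ← integral_const_mul]
      congr 1; ext y
      rw [mul_comm]
      congr 3
      push_cast; ring
    · have hp : Integrable (fun p : ℝ × ℝ => (1 : ℂ) * limitCharFun μ p.2)
          ((gaussianReal 0 w).prod volume) :=
        (integrable_const (1 : ℂ)).mul_prod hμ.integrable_limitCharFun
      simp only [one_mul] at hp
      have hc : Continuous fun p : ℝ × ℝ => Complex.exp ((-(p.2 * p.1) : ℝ) * Complex.I) := by
        fun_prop
      exact hp.bdd_mul (c := 1) hc.aestronglyMeasurable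
        (.of_forall fun p => (Complex.norm_exp_ofReal_mul_I _).le)
  have h2 := congrArg norm h1
  rw [Complex.norm_real, Real.norm_of_nonneg (by
    have : 0 ≤ ∫ y, limitDensity μ y ∂gaussianReal 0 w :=
      integral_nonneg fun y => hμ.limitDensity_nonneg y
    have := Real.pi_pos
    positivity)] at h2
  rw [h2]
  have hw' : (0 : ℝ) < w := by exact_mod_cast hw
  have h3 := integral_gaussian (w / 2 : ℝ)
  rw [← div_mul, mul_comm (Real.pi / _), ← mul_div_assoc] at h3
  rw [← h3]
  refine norm_integral_le_of_norm_le (integrable_exp_neg_mul_sq (by positivity))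
    (.of_forall fun s => ?_)
  rw [norm_mul, charFun_gaussianReal, Complex.norm_exp]
  refine (mul_le_of_le_one_left (Real.exp_pos _).le (hμ.norm_limitCharFun_le_one s)).trans_eq ?_
  congr 1
  have : ((-s : ℝ) * (0 : ℝ) * Complex.I - (w : ℝ) * (-s : ℝ) ^ 2 / 2 : ℂ) =
      ((-(w / 2) * s ^ 2 : ℝ) : ℂ) := by push_cast; ring
  have h4 := congrArg Complex.re this
  rw [Complex.ofReal_re] at h4
  exact h4

lemma exists_limitDensity_le {μ : ℕ → Measure ℤ} (hμ : IsQuicksortLaw μ) :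
    ∃ B, ∀ y, |limitDensity μ y| ≤ B := by
  refine ⟨(∫ s, ‖limitCharFun μ s‖) / (2 * Real.pi), fun y => ?_⟩
  rw [limitDensity, abs_div, abs_of_pos (by positivity : 0 < 2 * Real.pi)]
  gcongr
  refine (Complex.abs_re_le_norm _).trans (norm_integral_le_of_norm_le
    hμ.integrable_limitCharFun.norm (.of_forall fun s => ?_))
  rw [norm_mul, Complex.norm_exp_ofReal_mul_I, one_mul]

lemma integrable_limitDensity {μ : ℕ → Measure ℤ} (hμ : IsQuicksortLaw μ) :
    Integrable (limitDensity μ) := by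
  have hcont := hμ.continuous_limitDensity
  have hpi := Real.pi_pos
  set h : ℕ → ℝ → ℝ := fun n y =>
    √(2 * Real.pi * (n + 1)) * (gaussianPDFReal 0 (n + 1) y * limitDensity μ y) with hh
  have hh' : ∀ n y, h n y = Real.exp (-y ^ 2 / (2 * (n + 1))) * limitDensity μ y := by
    intro n y
    simp only [hh, gaussianPDFReal, sub_zero]
    push_cast
    have : 0 < √(2 * Real.pi * ((n : ℝ) + 1)) := by positivity
    field_simp
  have hlim : ∀ y, Tendsto (fun n => ENNReal.ofReal (h n y)) atTop
      (nhds (ENNReal.ofReal (limitDensity μ y))) := by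
    intro y
    refine ENNReal.tendsto_ofReal ?_
    simp only [hh']
    have h1 : Tendsto (fun n : ℕ => -y ^ 2 / (2 * ((n : ℝ) + 1))) atTop (nhds 0) :=
      tendsto_const_nhds.div_atTop (Tendsto.const_mul_atTop (by norm_num)
        (tendsto_atTop_add_const_right _ _ tendsto_natCast_atTop_atTop))
    have h2 := ((Real.continuous_exp.tendsto 0).comp h1).mul_const (limitDensity μ y)
    simpa using h2
  obtain ⟨B, hB⟩ := hμ.exists_limitDensity_le
  have hle : ∀ n, ∫⁻ y, ENNReal.ofReal (h n y) ≤ 1 := by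
    intro n
    have hne : ((n : ℝ≥0) + 1) ≠ 0 := by positivity
    have h_int : Integrable (h n) :=
      ((integrable_gaussianPDFReal 0 (n + 1)).mul_bdd (c := B) hcont.aestronglyMeasurable
        (.of_forall hB)).const_mul _
    rw [← ofReal_integral_eq_lintegral_ofReal h_int (.of_forall fun y => by
      rw [hh']; exact mul_nonneg (Real.exp_pos _).le (hμ.limitDensity_nonneg y))]
    rw [ENNReal.ofReal_le_one, hh, integral_const_mul]
    have h1 := hμ.integral_limitDensity_gaussianReal_le (w := n + 1) (by positivity)
    rw [integral_gaussianReal_eq_integral_smul hne] at h1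
    simp only [smul_eq_mul] at h1
    push_cast at h1
    have h2 : √(2 * Real.pi * ((n : ℝ) + 1)) * √(2 * Real.pi / ((n : ℝ) + 1)) =
        2 * Real.pi := by
      rw [← Real.sqrt_mul (by positivity)]
      rw [show 2 * Real.pi * ((n : ℝ) + 1) * (2 * Real.pi / ((n : ℝ) + 1)) = (2 * Real.pi) ^ 2 by
        field_simp]
      exact Real.sqrt_sq (by positivity)
    have h3 := mul_le_mul_of_nonneg_left h1 (Real.sqrt_nonneg (2 * Real.pi * ((n : ℝ) + 1)))
    rw [h2, mul_left_comm] at h3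
    exact le_of_mul_le_mul_left (by linarith) (by positivity : 0 < 2 * Real.pi)
  refine ⟨hcont.aestronglyMeasurable, ?_⟩
  rw [hasFiniteIntegral_iff_ofReal (.of_forall hμ.limitDensity_nonneg)]
  have hfatou := lintegral_liminf_le' (μ := volume) (u := atTop)
    (f := fun n y => ENNReal.ofReal (h n y)) fun n => by
      simp only [hh']
      exact Continuous.aemeasurable (ENNReal.continuous_ofReal.comp (by fun_prop))
  simp only [fun y => (hlim y).liminf_eq] at hfatou
  refine lt_of_le_of_lt hfatou (lt_of_le_of_lt
    (liminf_le_liminf (v := fun _ => 1) (.of_forall hle)) ?_)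
  simp

open scoped FourierTransform in
/-- Fourier inversion: `limitCharFun` is the characteristic function of `limitDensity`. -/
lemma integral_exp_mul_limitDensity {μ : ℕ → Measure ℤ} (hμ : IsQuicksortLaw μ) (s : ℝ) :
    ∫ y : ℝ, Complex.exp ((s * y : ℝ) * Complex.I) * (limitDensity μ y : ℂ) =
      limitCharFun μ s := by
  have hpi := Real.pi_pos
  have h1 : 𝓕 (limitCharFun μ) =
      fun v => 2 * Real.pi * (limitDensity μ (2 * Real.pi * v) : ℂ) := by
    ext v
    rw [Real.fourier_real_eq_integral_exp_smul, hμ.ofReal_limitDensity]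
    congr 1; ext t
    rw [smul_eq_mul]
    congr 3
    push_cast; ring
  have h2 : Integrable (𝓕 (limitCharFun μ)) := by
    rw [h1]
    exact (Integrable.comp_mul_left' (g := fun y => (limitDensity μ y : ℂ))
      hμ.integrable_limitDensity.ofReal (by positivity)).const_mul _
  have h3 := congrFun (hμ.continuous_limitCharFun.fourierInv_fourier_eq
    hμ.integrable_limitCharFun h2) s
  rw [← h3, Real.fourierInv_eq', h1]
  have h4 := Measure.integral_comp_mul_left (fun y : ℝ =>
    Complex.exp ((s * y : ℝ) * Complex.I) * (limitDensity μ y : ℂ)) (2 * Real.pi)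
  rw [abs_of_pos (by positivity), Complex.real_smul] at h4
  have h5 : (∫ y : ℝ, Complex.exp ((s * y : ℝ) * Complex.I) * (limitDensity μ y : ℂ)) =
      2 * Real.pi * ∫ v : ℝ, Complex.exp ((s * (2 * Real.pi * v) : ℝ) * Complex.I) *
        (limitDensity μ (2 * Real.pi * v) : ℂ) := by
    rw [h4, ← mul_assoc]
    push_cast
    rw [mul_inv_cancel₀ (by exact_mod_cast (by positivity : 2 * Real.pi ≠ 0)), one_mul]
  rw [h5, ← integral_const_mul]
  congr 1; ext v
  simp only [smul_eq_mul, RCLike.inner_apply, conj_trivial]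
  rw [mul_left_comm]
  congr 3
  push_cast; ring

lemma integral_limitDensity {μ : ℕ → Measure ℤ} (hμ : IsQuicksortLaw μ) :
    ∫ y, limitDensity μ y = 1 := by
  have h := hμ.integral_exp_mul_limitDensity 0
  rw [hμ.limitCharFun_zero] at h
  simp only [zero_mul, Complex.ofReal_zero, Complex.exp_zero, one_mul] at h
  rw [integral_complex_ofReal] at h
  exact_mod_cast h

/-- Weak convergence of the normalized laws. -/
lemma tendsto_integral_map {μ : ℕ → Measure ℤ} (hμ : IsQuicksortLaw μ) (g : ℝ →ᵇ ℝ) :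
    Tendsto (fun n : ℕ => ∫ y, g y ∂((μ n).map (fun k : ℤ => ((k : ℝ) - meanZ (μ n)) / n)))
      atTop (nhds (∫ y, g y ∂((volume : Measure ℝ).withDensity
        (fun x => ENNReal.ofReal (limitDensity μ x))))) := by
  have hmeas (n : ℕ) : Measurable fun k : ℤ => ((k : ℝ) - meanZ (μ n)) / n := measurable_from_top
  have hprob (n : ℕ) : IsProbabilityMeasure
      ((μ n).map (fun k : ℤ => ((k : ℝ) - meanZ (μ n)) / n)) :=
    have := hμ.1 n
    Measure.isProbabilityMeasure_map (hmeas n).aemeasurable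
  have hprob' : IsProbabilityMeasure ((volume : Measure ℝ).withDensity
      (fun x => ENNReal.ofReal (limitDensity μ x))) := by
    constructor
    rw [withDensity_apply _ MeasurableSet.univ, Measure.restrict_univ,
      ← ofReal_integral_eq_lintegral_ofReal hμ.integrable_limitDensity
      (.of_forall hμ.limitDensity_nonneg), hμ.integral_limitDensity, ENNReal.ofReal_one]
  refine (ProbabilityMeasure.tendsto_iff_forall_integral_tendsto
    (μs := fun n => ⟨_, hprob n⟩) (μ := ⟨_, hprob'⟩)).1 ?_ g
  refine ProbabilityMeasure.tendsto_of_tendsto_charFun fun s => ?_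
  have h1 : charFun ((volume : Measure ℝ).withDensity
      (fun x => ENNReal.ofReal (limitDensity μ x))) s = limitCharFun μ s := by
    rw [charFun_apply_real, integral_withDensity_eq_integral_toReal_smul
      hμ.continuous_limitDensity.measurable.ennreal_ofReal (by simp),
      ← hμ.integral_exp_mul_limitDensity]
    congr 1; ext y
    rw [ENNReal.toReal_ofReal (hμ.limitDensity_nonneg y), Complex.real_smul, mul_comm]
    push_cast; rfl
  have h2 (n : ℕ) : charFun ((μ n).map (fun k : ℤ => ((k : ℝ) - meanZ (μ n)) / n)) s =
      centeredCharFun (μ n) (s / n) := by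
    rw [charFun_apply_real, integral_map (hmeas n).aemeasurable
      (Continuous.aestronglyMeasurable (by fun_prop)), centeredCharFun]
    congr 1; ext k
    congr 2
    push_cast; ring
  change Tendsto (fun n : ℕ => charFun ((μ n).map fun k : ℤ => ((k : ℝ) - meanZ (μ n)) / n) s)
    atTop (nhds (charFun ((volume : Measure ℝ).withDensity
      (fun x => ENNReal.ofReal (limitDensity μ x))) s))
  simp only [h1, h2]
  have h3 : Tendsto (fun n : ℕ => centeredCharFun (μ n) (s / n) -
      centeredCharFun (μ n) (s / (n + 1))) atTop (nhds 0) := by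
    have h4 : Tendsto (fun n : ℕ => 7 * |s| / (n : ℝ)) atTop (nhds 0) :=
      tendsto_const_nhds.div_atTop tendsto_natCast_atTop_atTop
    refine squeeze_zero_norm' ?_ h4
    filter_upwards [eventually_gt_atTop 0] with n hn
    have hn' : (0 : ℝ) < n := by exact_mod_cast hn
    have h5 := hμ.lipschitz_centeredCharFun n (s / n * (n + 1)) s
    rw [mul_div_cancel_right₀ _ (by positivity),
      show s / n * (n + 1) - s = s / n by field_simp; ring, abs_div, abs_of_pos hn'] at h5
    rwa [mul_div_assoc]
  simpa using h3.add (hμ.tendsto_limitCharFun s)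

end IsQuicksortLaw

/-- The toll function of the QuickSort fixed-point equation. -/
noncomputable def quicksortToll (u : ℝ) : ℝ :=
  1 + 2 * (u * Real.log u) + 2 * ((1 - u) * Real.log (1 - u))

lemma continuous_quicksortToll : Continuous quicksortToll := by
  have h := Real.continuous_mul_log
  have h' : Continuous fun u : ℝ => (1 - u) * Real.log (1 - u) :=
    h.comp (continuous_const.sub continuous_id)
  unfold quicksortToll
  fun_prop

lemma exists_quicksortToll_eq {d : ℝ} (hd : |d| ≤ 3 / 10) :
    ∃ u, 0 < u ∧ u < 1 ∧ quicksortToll u = d := by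
  have h0 : quicksortToll 0 = 1 := by simp [quicksortToll]
  have h1 : quicksortToll (1 / 2) ≤ -(3 / 10) := by
    have : (1 - 1 / 2 : ℝ) = 2⁻¹ := by norm_num
    rw [quicksortToll, this, one_div, Real.log_inv]
    linarith [Real.log_two_gt_d9]
  obtain ⟨u, hu, rfl⟩ := intermediate_value_Icc' (by norm_num : (0 : ℝ) ≤ 1 / 2)
    continuous_quicksortToll.continuousOn
    ⟨h1.trans (abs_le.1 hd).1, (abs_le.1 hd).2.trans (by rw [h0]; norm_num)⟩
  refine ⟨u, hu.1.lt_of_ne ?_, by linarith [hu.2], rfl⟩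
  rintro rfl
  rw [h0] at hd
  norm_num at hd

namespace IsQuicksortLaw

/-- The error term in the expansion of the mean of `Q_n`. -/
lemma abs_mean_sub_le {μ : ℕ → Measure ℤ} (hμ : IsQuicksortLaw μ) (n : ℕ) :
    |meanZ (μ n) - (2 * (n * Real.log n) +
      (2 * Real.eulerMascheroniConstant - 4) * n)| ≤ 2 + 4 * √(n : ℝ) := by
  rcases Nat.eq_zero_or_pos n with rfl | hn
  · simp [hμ.mean_eq]
  have hn' : (0 : ℝ) < n := by exact_mod_cast hn
  have h1 := Real.eulerMascheroniSeq_lt_eulerMascheroniConstant n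
  have h2 := Real.eulerMascheroniConstant_lt_eulerMascheroniSeq' n
  rw [Real.eulerMascheroniSeq] at h1
  rw [Real.eulerMascheroniSeq', if_neg hn.ne'] at h2
  have h3 : Real.log (n + 1) - Real.log n ≤ 1 / n := by
    rw [← Real.log_div (by positivity) hn'.ne']
    refine (Real.log_le_sub_one_of_pos (by positivity)).trans_eq ?_
    field_simp; ring
  have h4 := harmonic_le_two_sqrt n
  set H : ℝ := ((harmonic n : ℚ) : ℝ)
  have h5 : 0 ≤ H := by
    simp only [H, harmonic]; push_cast; exact Finset.sum_nonneg fun _ _ => by positivity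
  have h6 : (n : ℝ) * (H - Real.log n - Real.eulerMascheroniConstant) ≤ 1 := by
    calc _ ≤ (n : ℝ) * (1 / n) := by gcongr; linarith
      _ = 1 := by field_simp
  have h7 : 0 ≤ (n : ℝ) * (H - Real.log n - Real.eulerMascheroniConstant) :=
    mul_nonneg hn'.le (by linarith)
  rw [hμ.mean_eq, abs_le]
  constructor <;> nlinarith

lemma abs_toll_sub_le {μ : ℕ → Measure ℤ} (hμ : IsQuicksortLaw μ) {i j m : ℕ} (hm : 1 ≤ m)
    (hij : j + i = m) :
    |m + meanZ (μ j) + meanZ (μ i) - meanZ (μ (m + 1)) - m * quicksortToll (j / m)| ≤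
      24 * √((m : ℝ) + 1) := by
  have hm' : (0 : ℝ) < m := by exact_mod_cast hm
  have hij' : (i : ℝ) = m - j := by rw [← hij]; push_cast; ring
  have hlog (k : ℕ) : (k : ℝ) * Real.log k =
      m * ((k / m : ℝ) * Real.log (k / m)) + k * Real.log m := by
    rcases Nat.eq_zero_or_pos k with rfl | hk
    · simp
    have hk' : (0 : ℝ) < k := by exact_mod_cast hk
    rw [Real.log_div hk'.ne' hm'.ne']
    field_simp; ring
  have e1 : 1 - (j / m : ℝ) = i / m := by rw [hij']; field_simp
  have h1 := hμ.abs_mean_sub_le i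
  have h2 := hμ.abs_mean_sub_le j
  have h3 := hμ.abs_mean_sub_le m
  rw [hlog] at h1 h2
  have h4 : meanZ (μ (m + 1)) - meanZ (μ m) = 2 * ((harmonic (m + 1) : ℚ) : ℝ) - 2 := by
    rw [hμ.mean_eq, hμ.mean_eq, harmonic_cast_succ]; push_cast; field_simp; ring
  have h5 := harmonic_le_two_sqrt (m + 1)
  have h6 : 0 ≤ ((harmonic (m + 1) : ℚ) : ℝ) := by
    simp only [harmonic]; push_cast; exact Finset.sum_nonneg fun _ _ => by positivity
  push_cast at h5
  have hs (k : ℕ) (hk : k ≤ m) : √(k : ℝ) ≤ √((m : ℝ) + 1) := by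
    apply Real.sqrt_le_sqrt
    have : (k : ℝ) ≤ m := by exact_mod_cast hk
    linarith
  have hsi := hs i (by omega)
  have hsj := hs j (by omega)
  have hsm := hs m le_rfl
  have hs1 : 1 ≤ √((m : ℝ) + 1) := Real.one_le_sqrt.2 (by linarith)
  have e2 : (i : ℝ) * Real.log m = m * Real.log m - j * Real.log m := by rw [hij']; ring
  have e3 : (2 * Real.eulerMascheroniConstant - 4) * (i : ℝ) =
      (2 * Real.eulerMascheroniConstant - 4) * m - (2 * Real.eulerMascheroniConstant - 4) * j := by
    rw [hij']; ring
  rw [quicksortToll, e1]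
  rw [e2, e3] at h1
  rw [abs_le] at h1 h2 h3 ⊢
  constructor <;> linarith

lemma le_mul_measure_singleton_succ {μ : ℕ → Measure ℤ} (hμ : IsQuicksortLaw μ) {m L : ℕ} {x : ℤ}
    {J : Finset ℕ} (hJ : J ⊆ Finset.range (m + 1)) {A : ℕ → Finset ℤ} {κ : ℝ}
    (hA : ∀ j ∈ J, (A j).card = L)
    (h : ∀ j ∈ J, ∀ a ∈ A j, κ ≤ (μ j).real {a} * (μ (m - j)).real {x - m - a}) :
    J.card * (L * κ) ≤ ((m : ℝ) + 1) * (μ (m + 1)).real {x} := by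
  have hp := hμ.1
  have h1 := hμ.integral_succ m (Set.indicator {x} fun _ => (1 : ℝ))
  have h2 (j : ℕ) (a : ℤ) : ∫ b, Set.indicator {x} (fun _ => (1 : ℝ)) (a + b + m) ∂μ j =
      (μ j).real {x - m - a} := by
    rw [← integral_indicator_one (measurableSet_singleton _)]
    congr 1; ext b
    simp only [Set.indicator_apply, Set.mem_singleton_iff, Pi.one_apply]
    congr 1
    exact propext ⟨fun h => by omega, fun h => by omega⟩
  simp only [h2] at h1
  rw [Finset.Nat.sum_antidiagonal_eq_sum_range_succ
    (fun i j => ∫ a, (μ j).real {x - m - a} ∂μ i)] at h1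
  have h3 : ∫ k, Set.indicator {x} (fun _ => (1 : ℝ)) k ∂μ (m + 1) = (μ (m + 1)).real {x} :=
    integral_indicator_one (measurableSet_singleton _)
  rw [h3, smul_eq_mul] at h1
  rw [h1, ← nsmul_eq_mul]
  refine le_trans (Finset.card_nsmul_le_sum J _ _ fun j hj => ?_)
    (Finset.sum_le_sum_of_subset_of_nonneg hJ fun j _ _ =>
      integral_nonneg fun a => measureReal_nonneg)
  refine le_trans ?_ (setIntegral_le_integral (s := (A j : Set ℤ)) (hμ.integrable _ _)
    (.of_forall fun a => measureReal_nonneg))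
  rw [setIntegral_finset _ (hμ.integrable _ _).integrableOn, ← hA j hj, ← nsmul_eq_mul]
  exact Finset.card_nsmul_le_sum _ _ _ fun a ha => h j hj a ha

lemma exists_le_mul_measure_singleton {μ : ℕ → Measure ℤ} (hμ : IsQuicksortLaw μ) {x₀ : ℝ}
    (hx₀ : 0 < limitDensity μ x₀) :
    ∃ η > 0, ∃ c > 0, ∃ N ≥ 1, ∀ j ≥ N, ∀ a : ℤ, |(a : ℝ) - meanZ (μ j) - j * x₀| ≤ η * j →
      c ≤ j * (μ j).real {a} := by
  obtain ⟨C, hC⟩ := hμ.exists_abs_mul_measure_singleton_sub_le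
  obtain ⟨η, hη, hball⟩ := Metric.eventually_nhds_iff.1
    (hμ.continuous_limitDensity.continuousAt.eventually
      (lt_mem_nhds (by linarith : limitDensity μ x₀ / 2 < limitDensity μ x₀)))
  obtain ⟨N, hN⟩ := eventually_atTop.1 ((tendsto_rpow_neg_one_div_sixteen C).eventually
    (gt_mem_nhds (by linarith : 0 < limitDensity μ x₀ / 4)))
  refine ⟨η / 2, by positivity, limitDensity μ x₀ / 4, by positivity, max N 1, le_max_right _ _,
    fun j hj a ha => ?_⟩
  have hj1 : 1 ≤ j := (le_max_right _ _).trans hj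
  have hj0 : (0 : ℝ) < j := by exact_mod_cast hj1
  have h1 := hN j ((le_max_left _ _).trans hj)
  have h2 := abs_le.1 (hC j hj1 a)
  have h3 : limitDensity μ x₀ / 2 < limitDensity μ (((a : ℝ) - meanZ (μ j)) / j) := by
    apply hball
    rw [Real.dist_eq, div_sub' hj0.ne', abs_div, abs_of_pos hj0, div_lt_iff₀ hj0]
    nlinarith
  rw [Measure.real]
  linarith [h2.1]

lemma div_mul_div_le_measure_mul {μ : ℕ → Measure ℤ} (hμ : IsQuicksortLaw μ)
    {x₀ t η η₁ c : ℝ} {N m j : ℕ} {x a : ℤ} (hc : 0 < c) (hm : 1 ≤ m) (hjm : j ≤ m)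
    (hlow : ∀ j ≥ N, ∀ a : ℤ, |(a : ℝ) - meanZ (μ j) - j * x₀| ≤ η * j → c ≤ j * (μ j).real {a})
    (hNj : N ≤ j) (hNi : N ≤ m - j) (hj : η₁ * m ≤ η * j) (hi : 4 * (η₁ * m) ≤ η * (m - j))
    (ha : |(a : ℝ) - meanZ (μ j) - j * x₀| ≤ η₁ * m) (hv : |quicksortToll (j / m) - t| ≤ η₁)
    (hx : |(x : ℝ) - (m + 1) * (x₀ + t) - meanZ (μ (m + 1))| ≤ 1)
    (herr : 1 + |x₀| + |t| + 24 * √((m : ℝ) + 1) ≤ 2 * (η₁ * m)) :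
    c / m * (c / m) ≤ (μ j).real {a} * (μ (m - j)).real {x - m - a} := by
  have hp := hμ.1
  have hm0 : (0 : ℝ) < m := by exact_mod_cast hm
  have hcast : ((m - j : ℕ) : ℝ) = m - j := Nat.cast_sub hjm
  have hsingle : ∀ k : ℕ, N ≤ k → k ≤ m → ∀ b : ℤ,
      |(b : ℝ) - meanZ (μ k) - k * x₀| ≤ η * k → c / m ≤ (μ k).real {b} := by
    intro k hk hkm b hb
    have h2 : (k : ℝ) ≤ m := by exact_mod_cast hkm
    rw [div_le_iff₀ hm0, mul_comm]
    exact (hlow k hk b hb).trans (by gcongr)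
  have htoll := hμ.abs_toll_sub_le hm (Nat.add_sub_cancel' hjm)
  have hv' : |(m : ℝ) * quicksortToll (j / m) - m * t| ≤ η₁ * m := by
    rw [← mul_sub, abs_mul, abs_of_pos hm0, mul_comm]
    gcongr
  have h1 := hsingle j hNj hjm a (ha.trans hj)
  have h2 := hsingle (m - j) hNi (Nat.sub_le _ _) (x - m - a) (by
    rw [hcast]
    refine le_trans ?_ hi
    push_cast
    have hx0 := abs_le.1 (le_refl |x₀|)
    have ht0 := abs_le.1 (le_refl |t|)
    rw [abs_le] at htoll hv' ha hx ⊢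
    constructor <;> linarith)
  gcongr

lemma limitDensity_add_toll_pos {μ : ℕ → Measure ℤ} (hμ : IsQuicksortLaw μ) {x₀ u : ℝ}
    (hx₀ : 0 < limitDensity μ x₀) (hu0 : 0 < u) (hu1 : u < 1) :
    0 < limitDensity μ (x₀ + quicksortToll u) := by
  obtain ⟨C, hC⟩ := hμ.exists_abs_mul_measure_singleton_sub_le
  obtain ⟨η, hη, c, hc, N, hN1, hlow⟩ := hμ.exists_le_mul_measure_singleton hx₀
  obtain ⟨l, hl0, hlu, hlu'⟩ : ∃ l > 0, l ≤ u ∧ 2 * l ≤ 1 - u :=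
    ⟨min u ((1 - u) / 2), lt_min hu0 (by linarith), min_le_left _ _, by
      linarith [min_le_right u ((1 - u) / 2)]⟩
  set η₁ : ℝ := η * l / 4 with hη₁
  have hη₁0 : 0 < η₁ := by positivity
  obtain ⟨δ₀, hδ₀, hball⟩ := Metric.eventually_nhds_iff.1
    (Metric.tendsto_nhds.1 (continuous_quicksortToll.tendsto u) η₁ hη₁0)
  obtain ⟨δ, hδ, hδδ₀, hδl⟩ : ∃ δ > 0, δ < δ₀ ∧ δ ≤ l :=
    ⟨min (δ₀ / 2) l, lt_min (by linarith) hl0,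
      (min_le_left _ _).trans_lt (by linarith), min_le_right _ _⟩
  set y : ℝ := x₀ + quicksortToll u with hy
  set κ : ℝ := δ * η₁ * c ^ 2 / 4 with hκ
  have hκ0 : 0 < κ := by positivity
  suffices hmain : ∀ᶠ m : ℕ in atTop, κ ≤ ((m + 1 : ℕ) : ℝ) *
      (μ (m + 1)).real {⌊((m + 1 : ℕ) : ℝ) * y + 0 + meanZ (μ (m + 1))⌋} by
    have h1 := (hμ.continuous_limitDensity.tendsto y).comp
      (tendsto_floor_sub_div y 0 fun n => meanZ (μ n))
    have h2 := (h1.add (tendsto_rpow_neg_one_div_sixteen C)).comp (tendsto_add_atTop_nat 1)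
    rw [add_zero] at h2
    refine hκ0.trans_le (ge_of_tendsto h2 ?_)
    filter_upwards [hmain] with m hm
    have h3 := (abs_le.1 (hC (m + 1) (by omega)
      ⌊((m + 1 : ℕ) : ℝ) * y + 0 + meanZ (μ (m + 1))⌋)).2
    rw [Measure.real] at hm
    simp only [Function.comp]
    linarith
  have hsqrt : Tendsto (fun m : ℕ => (1 + |x₀| + |quicksortToll u|) / ((m : ℝ) + 1) +
      24 / √((m : ℝ) + 1)) atTop (nhds 0) := by
    have h1 : Tendsto (fun m : ℕ => (m : ℝ) + 1) atTop atTop :=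
      tendsto_atTop_add_const_right _ _ tendsto_natCast_atTop_atTop
    simpa using (tendsto_const_nhds.div_atTop h1).add
      (tendsto_const_nhds.div_atTop (Real.tendsto_sqrt_atTop.comp h1))
  filter_upwards [hsqrt.eventually (gt_mem_nhds hη₁0),
    tendsto_natCast_atTop_atTop.eventually_ge_atTop (N / l),
    tendsto_natCast_atTop_atTop.eventually_ge_atTop (2 / δ),
    tendsto_natCast_atTop_atTop.eventually_ge_atTop (2 / η₁),
    eventually_ge_atTop 1] with m hm1 hm2 hm3 hm4 hm5
  have hm0 : (1 : ℝ) ≤ m := by exact_mod_cast hm5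
  have hm0' : (0 : ℝ) < m := by linarith
  have hδm := mul_le_mul_of_nonneg_right hδl hm0'.le
  have hlm := mul_le_mul_of_nonneg_right hlu hm0'.le
  have hlm' := mul_le_mul_of_nonneg_right hlu' hm0'.le
  have hlm0 := mul_pos hl0 hm0'
  rw [mul_assoc, sub_mul, one_mul] at hlm'
  have herr : 1 + |x₀| + |quicksortToll u| + 24 * √((m : ℝ) + 1) ≤ 2 * η₁ * m := by
    have h1 : 24 / √((m : ℝ) + 1) = 24 * √((m : ℝ) + 1) / (m + 1) := by
      rw [div_eq_div_iff (by positivity) (by positivity), mul_assoc,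
        Real.mul_self_sqrt (by positivity)]
    rw [h1, ← add_div, div_lt_iff₀ (by positivity)] at hm1
    linarith [mul_le_mul_of_nonneg_left hm0 hη₁0.le]
  rw [div_le_iff₀ (by positivity)] at hm2 hm3 hm4
  set x : ℤ := ⌊((m + 1 : ℕ) : ℝ) * y + 0 + meanZ (μ (m + 1))⌋ with hx
  have hx1 := Int.floor_le (((m + 1 : ℕ) : ℝ) * y + 0 + meanZ (μ (m + 1)))
  have hx2 := Int.lt_floor_add_one (((m + 1 : ℕ) : ℝ) * y + 0 + meanZ (μ (m + 1)))
  rw [← hx] at hx1 hx2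
  push_cast at hx1 hx2
  set L : ℕ := ⌊η₁ * m⌋₊ with hL
  set P : ℕ := ⌊δ * m⌋₊ with hP
  have hLle : (L : ℝ) ≤ η₁ * m := Nat.floor_le (by positivity)
  have hPle : (P : ℝ) ≤ δ * m := Nat.floor_le (by positivity)
  have hLge : η₁ * m / 2 ≤ L := by linarith [Nat.lt_floor_add_one (η₁ * m)]
  have hPge : δ * m / 2 ≤ P := by linarith [Nat.lt_floor_add_one (δ * m)]
  set J : Finset ℕ := Finset.Ico ⌈u * m⌉₊ (⌈u * m⌉₊ + P) with hJdef
  set A : ℕ → Finset ℤ := fun j =>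
    Finset.Ico ⌈meanZ (μ j) + j * x₀⌉ (⌈meanZ (μ j) + j * x₀⌉ + L) with hAdef
  have hJ : ∀ j ∈ J, u * m ≤ j ∧ (j : ℝ) ≤ u * m + δ * m := by
    intro j hj
    rw [hJdef, Finset.mem_Ico] at hj
    refine ⟨Nat.ceil_le.1 hj.1, ?_⟩
    have h1 : (j : ℝ) + 1 ≤ ⌈u * m⌉₊ + P := by exact_mod_cast hj.2
    have h2 := Nat.ceil_lt_add_one (by positivity : 0 ≤ u * m)
    linarith
  have hA : ∀ j, ∀ a ∈ A j, |(a : ℝ) - meanZ (μ j) - j * x₀| ≤ η₁ * m := by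
    intro j a ha
    simp only [hAdef, Finset.mem_Ico] at ha
    have h1 := Int.ceil_le.1 ha.1
    have h2 : (a : ℝ) + 1 ≤ ⌈meanZ (μ j) + j * x₀⌉ + L := by exact_mod_cast ha.2
    have h3 := Int.ceil_lt_add_one (meanZ (μ j) + j * x₀)
    rw [abs_le]
    constructor <;> linarith
  have hterm : ∀ j ∈ J, ∀ a ∈ A j,
      (c / m) * (c / m) ≤ (μ j).real {a} * (μ (m - j)).real {x - m - a} := by
    intro j hj a ha
    obtain ⟨hj1, hj2⟩ := hJ j hj
    have ha' := hA j a ha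
    have hjm : (j : ℝ) + l * m ≤ m := by linarith
    have hjm' : j ≤ m := by
      have : (j : ℝ) ≤ m := by linarith
      exact_mod_cast this
    have hcast : ((m - j : ℕ) : ℝ) = m - j := Nat.cast_sub hjm'
    have hjl : l * m ≤ j := by linarith
    have hil : l * m ≤ ((m - j : ℕ) : ℝ) := by rw [hcast]; linarith
    have hNj : N ≤ j := by
      have : (N : ℝ) ≤ j := by linarith
      exact_mod_cast this
    have hNi : N ≤ m - j := by
      have : (N : ℝ) ≤ (m - j : ℕ) := by linarith
      exact_mod_cast this
    have hv : |quicksortToll (j / m) - quicksortToll u| ≤ η₁ := by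
      refine (hball ?_).le
      rw [Real.dist_eq, div_sub' hm0'.ne', abs_div, abs_of_pos hm0', div_lt_iff₀ hm0',
        abs_of_nonneg (by linarith)]
      linarith [mul_lt_mul_of_pos_right hδδ₀ hm0']
    have hηj := mul_le_mul_of_nonneg_left hjl hη.le
    have hηi := mul_le_mul_of_nonneg_left hil hη.le
    have hη₁m : 4 * (η₁ * m) = η * (l * m) := by rw [hη₁]; ring
    refine hμ.div_mul_div_le_measure_mul hc hm5 hjm' hlow hNj hNi ?_ ?_ ha' hv ?_ (by linarith)
    · linarith [mul_pos hη₁0 hm0']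
    · rw [hη₁m, ← hcast]; exact hηi
    · rw [abs_le]
      constructor <;> linarith
  have hfin := hμ.le_mul_measure_singleton_succ (m := m) (L := L) (x := x) (J := J) (A := A)
    (κ := c / m * (c / m)) (fun j hj => ?_) (fun j _ => ?_) hterm
  · rw [hJdef, Nat.card_Ico, Nat.add_sub_cancel_left] at hfin
    push_cast
    refine le_trans ?_ hfin
    calc κ = (δ * m / 2) * ((η₁ * m / 2) * (c / m * (c / m))) := by
          rw [hκ]; field_simp; ring
      _ ≤ _ := by gcongr
  · have h1 := (hJ j hj).2
    have : (j : ℝ) ≤ m := by linarith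
    rw [Finset.mem_range]
    have : j ≤ m := by exact_mod_cast this
    omega
  · simp [hAdef]

lemma limitDensity_pos {μ : ℕ → Measure ℤ} (hμ : IsQuicksortLaw μ) (x : ℝ) :
    0 < limitDensity μ x := by
  obtain ⟨x₀, hx₀⟩ : ∃ x₀, 0 < limitDensity μ x₀ := by
    by_contra! hcon
    have h1 : limitDensity μ = 0 := by
      ext y; exact le_antisymm (hcon y) (hμ.limitDensity_nonneg y)
    have h2 := hμ.integral_limitDensity
    rw [h1] at h2
    simp at h2
  obtain ⟨n, hn⟩ := exists_nat_gt (|x - x₀| / (3 / 10))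
  have hn0 : (0 : ℝ) < n := lt_of_le_of_lt (by positivity) hn
  have hd : |(x - x₀) / n| ≤ 3 / 10 := by
    rw [div_lt_iff₀ (by norm_num)] at hn
    rw [abs_div, abs_of_pos hn0, div_le_iff₀ hn0]
    linarith
  have hstep : ∀ k : ℕ, 0 < limitDensity μ (x₀ + k * ((x - x₀) / n)) := by
    intro k
    induction k with
    | zero => simpa using hx₀
    | succ k ih =>
      obtain ⟨u, hu0, hu1, hu⟩ := exists_quicksortToll_eq hd
      have := hμ.limitDensity_add_toll_pos ih hu0 hu1
      rw [hu] at this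
      convert! this using 2
      push_cast; ring
  have := hstep n
  rwa [mul_div_cancel₀ _ hn0.ne', add_sub_cancel] at this

end IsQuicksortLaw

/-- **Local limit theorem for QuickSort.**  There exist a continuous, everywhere positive
probability density `f`, an `ε > 0` and a constant `C` such that the normalized QuickSort
comparison counts `(Q_n - q_n)/n` converge weakly to the law with density `f`, and
`|P(Q_n = x) - n⁻¹ f((x - q_n)/n)| ≤ C n^{-1-ε}` for all integers `n ≥ 1` and `x`. -/
theorem quicksort_local_limit_theorem
    (μ : ℕ → Measure ℤ) (hμ : IsQuicksortLaw μ) :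
    ∃ f : ℝ → ℝ, Continuous f ∧ (∀ x : ℝ, 0 < f x) ∧ (∫ x : ℝ, f x) = 1 ∧
      ∃ ε : ℝ, 0 < ε ∧ ∃ C : ℝ,
        (∀ g : ℝ →ᵇ ℝ,
          Tendsto
            (fun n : ℕ => ∫ y, g y ∂((μ n).map (fun k : ℤ => ((k : ℝ) - meanZ (μ n)) / n)))
            atTop
            (nhds (∫ y, g y ∂((volume : Measure ℝ).withDensity
              (fun x => ENNReal.ofReal (f x)))))) ∧
        (∀ n : ℕ, 1 ≤ n → ∀ x : ℤ,
          |((μ n) {x}).toReal - (n : ℝ)⁻¹ * f (((x : ℝ) - meanZ (μ n)) / n)|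
            ≤ C * (n : ℝ) ^ (-1 - ε : ℝ)) := by
  obtain ⟨C, hC⟩ := hμ.exists_abs_measure_singleton_sub_le
  exact ⟨limitDensity μ, hμ.continuous_limitDensity, hμ.limitDensity_pos,
    hμ.integral_limitDensity, 1 / 16, by norm_num, C, hμ.tendsto_integral_map, hC⟩
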